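/- arXiv:2512.02596 — 3 statements merged into one kernel-verified Lean document; each statement's English description precedes it below -/
import Mathlib

section
/- Let S be a dense subsemigroup of ((0,∞),+). Then: (i) if A ⊆ S is a P set near zero, then there exists p ∈ Prog(S₀) with A ∈ p (in particular Prog(S₀) is nonempty); (ii) Prog(S₀) is a closed subset of 0⁺(S) (with the subspace topology inherited from the Stone topology on the space of ultrafilters on S); (iii) Prog(S₀) is a two-sided ideal of 0⁺(S): for every p ∈ Prog(S₀) and q ∈ 0⁺(S), both q + p ∈ Prog(S₀) and p + q ∈ Prog(S₀). -/
open Set Filter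

attribute [local instance] Ultrafilter.add Ultrafilter.addSemigroup

/-- `A` is a *P set near zero* in a dense subsemigroup `S` of `((0,∞),+)`. -/
def PSetNearZero (S A : Set ℝ) : Prop :=
  ∀ k : ℕ, ∀ ε : ℝ, 0 < ε → ∃ a ∈ S, ∃ d ∈ S,
    ∀ t : ℕ, 1 ≤ t → t ≤ k → a + (t : ℝ) * d ∈ A ∩ Set.Ioo 0 ε

/-- `0⁺(S)`: the ultrafilters (on `ℝ`, identifying `βS` with the ultrafilters
containing `S`) containing `(0,ε) ∩ S` for every `ε > 0`. -/
def zeroPlus (S : Set ℝ) : Set (Ultrafilter ℝ) :=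
  {p | ∀ ε : ℝ, 0 < ε → (Set.Ioo 0 ε ∩ S) ∈ p}

/-- `Prog(S₀)`: the members of `0⁺(S)` all of whose members are P sets near zero. -/
def Prog (S : Set ℝ) : Set (Ultrafilter ℝ) :=
  {p | p ∈ zeroPlus S ∧ ∀ A : Set ℝ, A ∈ p → PSetNearZero S A}

open Combinatorics

theorem PSetNearZero.mono {S A B : Set ℝ} (hA : PSetNearZero S A) (hAB : A ⊆ B) :
    PSetNearZero S B := by
  intro k ε hε
  obtain ⟨a, ha, d, hd, h⟩ := hA k ε hε
  exact ⟨a, ha, d, hd, fun t h1 hk => ⟨hAB (h t h1 hk).1, (h t h1 hk).2⟩⟩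

theorem PSetNearZero.inter_Ioo_nonempty {S A : Set ℝ} (hA : PSetNearZero S A) {ε : ℝ}
    (hε : 0 < ε) : (A ∩ Ioo 0 ε).Nonempty := by
  obtain ⟨a, -, d, -, h⟩ := hA 1 ε hε
  exact ⟨_, h 1 le_rfl le_rfl⟩

theorem natCast_mul_mem_of_add_mem {S : Set ℝ} (hSadd : ∀ x ∈ S, ∀ y ∈ S, x + y ∈ S) {d : ℝ}
    (hd : d ∈ S) {n : ℕ} (hn : 0 < n) : (n : ℝ) * d ∈ S := by
  induction n, hn using Nat.le_induction with
  | base => simpa using hd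
  | succ n _ ih =>
    rw [Nat.cast_succ, add_one_mul]
    exact hSadd _ ih _ hd

/-- Along a combinatorial line in `ι → Fin (k + 1)`, the coordinate sum is an arithmetic
progression with positive common difference. -/
theorem Combinatorics.Line.exists_sum_eq {ι : Type*} [Fintype ι] {k : ℕ}
    (l : Line (Fin (k + 1)) ι) :
    ∃ b c : ℕ, 0 < c ∧ ∀ x : Fin (k + 1), ∑ i, (l x i : ℕ) = b + x * c := by
  classical
  refine ⟨∑ i with l.idxFun i ≠ none, ((l.idxFun i).getD 0 : Fin (k + 1)),
    (Finset.univ.filter fun i => l.idxFun i = none).card, ?_, fun x => ?_⟩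
  · obtain ⟨i, hi⟩ := l.proper
    exact Finset.card_pos.2 ⟨i, by simp [hi]⟩
  · rw [← Finset.sum_filter_add_sum_filter_not Finset.univ (fun i => l.idxFun i = none), add_comm]
    congr 1
    · refine Finset.sum_congr rfl fun i hi => ?_
      obtain ⟨y, hy⟩ := Option.ne_none_iff_exists'.1 (Finset.mem_filter.1 hi).2
      simp [Line.coe_apply, hy]
    · rw [mul_comm, ← smul_eq_mul, ← Finset.sum_const]
      refine Finset.sum_congr rfl fun i hi => ?_
      simp [Line.coe_apply, (Finset.mem_filter.1 hi).2]

/-- For a subsemigroup `S`, the property of being a P set near zero is partition regular. -/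
theorem PSetNearZero.of_union {S A B : Set ℝ} (hSadd : ∀ x ∈ S, ∀ y ∈ S, x + y ∈ S)
    (h : PSetNearZero S (A ∪ B)) : PSetNearZero S A ∨ PSetNearZero S B := by
  by_contra! hcon
  obtain ⟨hA, hB⟩ := hcon
  simp only [PSetNearZero, not_forall] at hA hB
  obtain ⟨k₁, ε₁, hε₁, hA⟩ := hA
  obtain ⟨k₂, ε₂, hε₂, hB⟩ := hB
  obtain ⟨ι, _, hι⟩ := Line.exists_mono_in_high_dimension (Fin (max k₁ k₂ + 1)) Prop
  obtain ⟨a, ha, d, hd, had⟩ :=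
    h (Fintype.card ι * max k₁ k₂ + 1) (min ε₁ ε₂) (lt_min hε₁ hε₂)
  obtain ⟨l, C, hl⟩ := hι fun v => a + ((∑ i, (v i : ℕ) + 1 : ℕ) : ℝ) * d ∈ A
  obtain ⟨b, c, hc, hsum⟩ := l.exists_sum_eq
  have ha' : a + ((b + 1 : ℕ) : ℝ) * d ∈ S :=
    hSadd _ ha _ (natCast_mul_mem_of_add_mem hSadd hd b.succ_pos)
  have hd' : (c : ℝ) * d ∈ S := natCast_mul_mem_of_add_mem hSadd hd hc
  have key : ∀ t ≤ max k₁ k₂,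
      (a + ((b + 1 : ℕ) : ℝ) * d + t * (c * d) ∈ A ↔ C) ∧
      a + ((b + 1 : ℕ) : ℝ) * d + t * (c * d) ∈ (A ∪ B) ∩ Ioo 0 (min ε₁ ε₂) := by
    intro t ht
    have hs := hsum ⟨t, Nat.lt_succ_of_le ht⟩
    have heq : a + ((b + 1 : ℕ) : ℝ) * d + t * (c * d) =
        a + ((∑ i, (l ⟨t, Nat.lt_succ_of_le ht⟩ i : ℕ) + 1 : ℕ) : ℝ) * d := by
      rw [hs]
      push_cast
      ring
    rw [heq]
    refine ⟨iff_of_eq (hl _), had _ (Nat.le_add_left _ _) (Nat.add_le_add_right ?_ 1)⟩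
    simpa using Finset.sum_le_card_nsmul Finset.univ
      (fun i => (l ⟨t, Nat.lt_succ_of_le ht⟩ i : ℕ)) (max k₁ k₂)
      fun i _ => Nat.le_of_lt_succ (Fin.is_lt _)
  by_cases hC : C
  · refine hA ⟨_, ha', _, hd', fun t _ ht => ?_⟩
    obtain ⟨h₁, -, h₂⟩ := key t (ht.trans (le_max_left _ _))
    exact ⟨h₁.2 hC, h₂.1, h₂.2.trans_le (min_le_left _ _)⟩
  · refine hB ⟨_, ha', _, hd', fun t _ ht => ?_⟩
    obtain ⟨h₁, h₂, h₃⟩ := key t (ht.trans (le_max_right _ _))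
    exact ⟨h₂.resolve_left fun h => hC (h₁.1 h), h₃.1, h₃.2.trans_le (min_le_right _ _)⟩

theorem PSetNearZero.exists_mem_prog {S A : Set ℝ} (hSadd : ∀ x ∈ S, ∀ y ∈ S, x + y ∈ S)
    (hAS : A ⊆ S) (hA : PSetNearZero S A) : ∃ p ∈ Prog S, A ∈ p := by
  have not_empty : ¬ PSetNearZero S ∅ := fun h => by
    simpa using h.inter_Ioo_nonempty one_pos
  let F : Filter ℝ := Filter.comk (fun B => ¬ PSetNearZero S (A ∩ B))
    (by simpa using not_empty)
    (fun t ht s hst hs => ht (hs.mono (inter_subset_inter_right A hst)))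
    (fun s hs t ht hst => by
      rw [inter_union_distrib_left] at hst
      exact (hst.of_union hSadd).elim hs ht)
  have mem_F : ∀ B, B ∈ F ↔ ¬ PSetNearZero S (A ∩ Bᶜ) := fun B => Iff.rfl
  have : F.NeBot := ⟨fun h => by
    have h' : ∅ ∈ F := h ▸ mem_bot
    rw [mem_F] at h'
    simp [hA] at h'⟩
  have hle : ↑(Ultrafilter.of F) ≤ F := Ultrafilter.of_le F
  refine ⟨Ultrafilter.of F, ⟨fun ε hε => hle ((mem_F _).2 fun h => ?_), fun B hB => ?_⟩,
    hle ((mem_F _).2 (by simpa using not_empty))⟩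
  · obtain ⟨x, ⟨hxA, hx⟩, hxε⟩ := h.inter_Ioo_nonempty hε
    exact hx ⟨hxε, hAS hxA⟩
  · by_contra h
    refine Ultrafilter.compl_notMem_iff.2 hB (hle ((mem_F _).2 fun h' => h (h'.mono ?_)))
    simp

theorem isClosed_setOf_mem_prog (S : Set ℝ) :
    IsClosed {p : ↥(zeroPlus S) | (p : Ultrafilter ℝ) ∈ Prog S} := by
  have : {p : ↥(zeroPlus S) | (p : Ultrafilter ℝ) ∈ Prog S} =
      ⋂ (A : Set ℝ) (_ : ¬ PSetNearZero S A),
        Subtype.val ⁻¹' {p : Ultrafilter ℝ | A ∈ p}ᶜ := by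
    ext p
    simp only [Prog, mem_ofPred_eq, p.2, true_and, mem_iInter, mem_preimage, mem_compl_iff]
    exact forall_congr' fun A => not_imp_not.symm
  rw [this]
  exact isClosed_biInter fun A _ =>
    (ultrafilter_isOpen_basic A).isClosed_compl.preimage continuous_subtype_val

theorem add_mem_zeroPlus {S : Set ℝ} (hSadd : ∀ x ∈ S, ∀ y ∈ S, x + y ∈ S)
    {p q : Ultrafilter ℝ} (hp : p ∈ zeroPlus S) (hq : q ∈ zeroPlus S) : p + q ∈ zeroPlus S := by
  intro ε hε
  refine (Ultrafilter.eventually_add p q (· ∈ Ioo 0 ε ∩ S)).2 ?_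
  filter_upwards [hp (ε / 2) (half_pos hε)] with x hx
  filter_upwards [hq (ε / 2) (half_pos hε)] with y hy
  exact ⟨⟨by linarith [hx.1.1, hy.1.1], by linarith [hx.1.2, hy.1.2]⟩, hSadd _ hx.2 _ hy.2⟩

theorem add_mem_prog_left {S : Set ℝ} (hSadd : ∀ x ∈ S, ∀ y ∈ S, x + y ∈ S)
    {p q : Ultrafilter ℝ} (hp : p ∈ Prog S) (hq : q ∈ zeroPlus S) : q + p ∈ Prog S := by
  refine ⟨add_mem_zeroPlus hSadd hq hp.1, fun A hA k ε hε => ?_⟩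
  have hA' : ∀ᶠ x in q, ∀ᶠ y in p, x + y ∈ A := (Ultrafilter.eventually_add q p (· ∈ A)).1 hA
  obtain ⟨x, hxA, hx, hxS⟩ := (hA'.and (hq (ε / 2) (half_pos hε))).exists
  obtain ⟨a, ha, d, hd, h⟩ := hp.2 _ hxA k (ε / 2) (half_pos hε)
  refine ⟨x + a, hSadd _ hxS _ ha, d, hd, fun t h1 hk => ?_⟩
  obtain ⟨hA, h₁, h₂⟩ := h t h1 hk
  rw [add_assoc]
  exact ⟨hA, by linarith [hx.1], by linarith [hx.2]⟩

theorem add_mem_prog_right {S : Set ℝ} (hSadd : ∀ x ∈ S, ∀ y ∈ S, x + y ∈ S)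
    {p q : Ultrafilter ℝ} (hp : p ∈ Prog S) (hq : q ∈ zeroPlus S) : p + q ∈ Prog S := by
  refine ⟨add_mem_zeroPlus hSadd hp.1 hq, fun A hA k ε hε => ?_⟩
  have hA' : ∀ᶠ x in p, ∀ᶠ y in q, x + y ∈ A := (Ultrafilter.eventually_add p q (· ∈ A)).1 hA
  obtain ⟨a, ha, d, hd, h⟩ := hp.2 _ hA' k (ε / 2) (half_pos hε)
  have hall : ∀ᶠ y in q, ∀ t ∈ Finset.Icc 1 k, a + (t : ℝ) * d + y ∈ A :=
    (Filter.eventually_all_finset _).2 fun t ht =>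
      (h t (Finset.mem_Icc.1 ht).1 (Finset.mem_Icc.1 ht).2).1
  obtain ⟨y, hyA, hy, hyS⟩ := (hall.and (hq (ε / 2) (half_pos hε))).exists
  refine ⟨a + y, hSadd _ ha _ hyS, d, hd, fun t h1 hk => ?_⟩
  obtain ⟨-, h₁, h₂⟩ := h t h1 hk
  rw [add_right_comm]
  exact ⟨hyA t (Finset.mem_Icc.2 ⟨h1, hk⟩), by linarith [hy.1], by linarith [hy.2]⟩

/-- For a dense subsemigroup `S` of `((0,∞),+)`:
(i) every P set near zero belongs to some member of `Prog(S₀)` (so `Prog(S₀) ≠ ∅`);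
(ii) `Prog(S₀)` is closed in `0⁺(S)` (with the subspace topology from the Stone topology);
(iii) `Prog(S₀)` is a two-sided ideal of `0⁺(S)`. -/
theorem prog_nonempty_isClosed_isTwoSidedIdeal (S : Set ℝ)
    (hSpos : S ⊆ Set.Ioi 0)
    (hSadd : ∀ x ∈ S, ∀ y ∈ S, x + y ∈ S)
    (hSdense : ∀ a b : ℝ, 0 < a → a < b → ∃ s ∈ S, a < s ∧ s < b) :
    (∀ A : Set ℝ, A ⊆ S → PSetNearZero S A → ∃ p ∈ Prog S, A ∈ p) ∧
    IsClosed {p : ↥(zeroPlus S) | (p : Ultrafilter ℝ) ∈ Prog S} ∧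
    (∀ p ∈ Prog S, ∀ q ∈ zeroPlus S, q + p ∈ Prog S ∧ p + q ∈ Prog S) := by
  exact ⟨fun _ hAS hA => hA.exists_mem_prog hSadd hAS, isClosed_setOf_mem_prog S,
    fun _ hp _ hq => ⟨add_mem_prog_left hSadd hp hq, add_mem_prog_right hSadd hp hq⟩⟩
end

section
/- Let u, v ∈ ℕ and let M be a u × v matrix with entries from ℝ. Then the following are equivalent: (1) M is image partition regular over ℝ⁺; (2) M is image partition regular near zero over ℝ⁺; (3) for every central set C in ℝ⁺ there exists x ∈ (ℝ⁺)^v such that M·x ∈ C^u; (4) for every central set near zero C in ℝ⁺ there exists x ∈ (ℝ⁺)^v such that M·x ∈ C^u; (5) for every central set near zero C in ℝ⁺ and every ε > 0 there exists x ∈ (0,ε)^v such that M·x ∈ C^u. -/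
open Set Filter

attribute [local instance] Ultrafilter.add Ultrafilter.addSemigroup

/-- The positive reals `ℝ⁺ = (0,∞)` as a type, a discrete additive semigroup. -/
abbrev Rpos : Type := {x : ℝ // 0 < x}

/-- `0⁺(ℝ⁺)`: ultrafilters on `ℝ⁺` containing `(0,ε)` for every `ε > 0`. -/
def zeroPlus1 : Set (Ultrafilter Rpos) :=
  {p | ∀ ε : ℝ, 0 < ε → {x : Rpos | (x : ℝ) < ε} ∈ p}

/-- `0⁺((ℝ⁺)^v)`: ultrafilters on `(ℝ⁺)^v` containing `(0,ε)^v` for every `ε > 0`. -/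
def zeroPlusV (v : ℕ) : Set (Ultrafilter (Fin v → Rpos)) :=
  {p | ∀ ε : ℝ, 0 < ε → {x : Fin v → Rpos | ∀ j, (x j : ℝ) < ε} ∈ p}

/-- `I` is a (nonempty, two-sided) ideal of the subsemigroup `T` of the ultrafilter
semigroup `βγ`. -/
def IsIdealIn {γ : Type} [AddSemigroup γ] (T I : Set (Ultrafilter γ)) : Prop :=
  I.Nonempty ∧ I ⊆ T ∧ (∀ p ∈ T, ∀ q ∈ I, p + q ∈ I) ∧ ∀ p ∈ T, ∀ q ∈ I, q + p ∈ I

/-- `p` belongs to the smallest two-sided ideal `K(T)` of `T`: equivalently, `p ∈ T` and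
`p` belongs to every nonempty two-sided ideal of `T`. -/
def memK {γ : Type} [AddSemigroup γ] (T : Set (Ultrafilter γ)) (p : Ultrafilter γ) : Prop :=
  p ∈ T ∧ ∀ I : Set (Ultrafilter γ), IsIdealIn T I → p ∈ I

/-- `M` is image partition regular over `ℝ⁺` (IPR/ℝ⁺): whenever `ℝ⁺` is partitioned into
finitely many cells, there are a cell `i` and `x ∈ (ℝ⁺)^v` such that every entry of `M·x`
lies in `ℝ⁺` and in the cell `i`. -/
def IPR {u v : ℕ} (M : Fin u → Fin v → ℝ) : Prop :=
  ∀ (r : ℕ) (c : Rpos → Fin r), ∃ (i : Fin r) (x : Fin v → Rpos),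
    ∀ k : Fin u, ∃ h : 0 < ∑ j, M k j * (x j : ℝ), c ⟨∑ j, M k j * (x j : ℝ), h⟩ = i

/-- `M` is image partition regular near zero over `ℝ⁺`: whenever `ℝ⁺` is partitioned into
finitely many cells and `δ > 0`, there are a cell `i` and `x ∈ (ℝ⁺)^v` such that every
entry of `M·x` lies in the cell `i` and in `(0,δ)`. -/
def IPRNearZero {u v : ℕ} (M : Fin u → Fin v → ℝ) : Prop :=
  ∀ (r : ℕ) (c : Rpos → Fin r) (δ : ℝ), 0 < δ → ∃ (i : Fin r) (x : Fin v → Rpos),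
    ∀ k : Fin u, ∃ h : 0 < ∑ j, M k j * (x j : ℝ),
      (∑ j, M k j * (x j : ℝ)) < δ ∧ c ⟨∑ j, M k j * (x j : ℝ), h⟩ = i

/-- `C ⊆ ℝ⁺` is *central*: `C` belongs to some idempotent in `K(βℝ⁺)`. -/
def Central (C : Set ℝ) : Prop :=
  ∃ p : Ultrafilter Rpos, p + p = p ∧ memK Set.univ p ∧ {x : Rpos | (x : ℝ) ∈ C} ∈ p

/-- `C ⊆ ℝ⁺` is *central near zero*: `C` belongs to some idempotent in `K(0⁺(ℝ⁺))`. -/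
def CentralNearZero (C : Set ℝ) : Prop :=
  ∃ p : Ultrafilter Rpos, p + p = p ∧ memK zeroPlus1 p ∧ {x : Rpos | (x : ℝ) ∈ C} ∈ p

section UltrafilterSemigroup

variable {γ : Type} [AddSemigroup γ] {T : Set (Ultrafilter γ)}

lemma exists_idempotent_of_isClosed {X : Set (Ultrafilter γ)} (hne : X.Nonempty)
    (hcl : IsClosed X) (hadd : ∀ a ∈ X, ∀ b ∈ X, a + b ∈ X) : ∃ e ∈ X, e + e = e :=
  exists_idempotent_in_compact_add_subsemigroup Ultrafilter.continuous_add_left X hne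
    hcl.isCompact hadd

/-- A compact subsemigroup `T` contains a nonempty closed left ideal that is generated by each of
its elements. -/
lemma exists_minimal_leftIdeal (hne : T.Nonempty) (hcl : IsClosed T)
    (hadd : ∀ a ∈ T, ∀ b ∈ T, a + b ∈ T) :
    ∃ L : Set (Ultrafilter γ), L.Nonempty ∧ IsClosed L ∧ L ⊆ T ∧
      (∀ a ∈ T, ∀ b ∈ L, a + b ∈ L) ∧ ∀ l ∈ L, ∀ m ∈ L, ∃ t ∈ T, t + l = m := by
  obtain ⟨L, -, hL⟩ := zorn_superset_nonempty
    {L : Set (Ultrafilter γ) | L.Nonempty ∧ IsClosed L ∧ L ⊆ T ∧ ∀ a ∈ T, ∀ b ∈ L, a + b ∈ L}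
    (by
      intro c hc hchain hcne
      refine ⟨⋂₀ c, ⟨?_, isClosed_sInter fun s hs => (hc hs).2.1, ?_, ?_⟩,
        fun s hs => sInter_subset_of_mem hs⟩
      · have : Nonempty c := hcne.to_subtype
        exact IsCompact.nonempty_sInter_of_directed_nonempty_isCompact_isClosed
          (IsChain.directedOn hchain.symm) (fun s hs => (hc hs).1)
          (fun s hs => (hc hs).2.1.isCompact) (fun s hs => (hc hs).2.1)
      · obtain ⟨s, hs⟩ := hcne
        exact (sInter_subset_of_mem hs).trans (hc hs).2.2.1
      · exact fun a ha b hb s hs => (hc hs).2.2.2 a ha b (hb s hs))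
    T ⟨hne, hcl, Subset.rfl, hadd⟩
  obtain ⟨hLne, hLcl, hLT, hLadd⟩ := hL.prop
  refine ⟨L, hLne, hLcl, hLT, hLadd, fun l hl m hm => ?_⟩
  have hsub : (· + l) '' T ⊆ L := by
    rintro _ ⟨t, ht, rfl⟩
    exact hLadd t ht l hl
  have := hL.le_of_le (y := (· + l) '' T)
    ⟨hne.image _, (hcl.isCompact.image (Ultrafilter.continuous_add_left l)).isClosed,
      hsub.trans hLT, by
        rintro a ha _ ⟨t, ht, rfl⟩
        exact ⟨a + t, hadd a ha t ht, add_assoc a t l⟩⟩ hsub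
  exact this hm

/-- The smallest ideal of a compact subsemigroup contains an idempotent. -/
lemma exists_idempotent_memK (hne : T.Nonempty) (hcl : IsClosed T)
    (hadd : ∀ a ∈ T, ∀ b ∈ T, a + b ∈ T) : ∃ p, p + p = p ∧ memK T p := by
  obtain ⟨L, hLne, hLcl, hLT, hLadd, hLmin⟩ := exists_minimal_leftIdeal hne hcl hadd
  obtain ⟨e, heL, he⟩ := exists_idempotent_of_isClosed hLne hLcl
    fun a ha b hb => hLadd a (hLT ha) b hb
  refine ⟨e, he, hLT heL, ?_⟩
  rintro I ⟨⟨i, hi⟩, hIT, hIl, hIr⟩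
  obtain ⟨t, ht, hte⟩ := hLmin (i + e) (hLadd i (hIT hi) e heL) e heL
  rw [← hte]
  exact hIl t ht _ (hIr e (hLT heL) i hi)

/-- An element of the smallest ideal generates a minimal left ideal. -/
lemma memK.exists_add_add_eq {p : Ultrafilter γ} (hp : memK T p) (hcl : IsClosed T)
    (hadd : ∀ a ∈ T, ∀ b ∈ T, a + b ∈ T) : ∀ s ∈ T, ∃ w ∈ T, w + (s + p) = p := by
  obtain ⟨L, ⟨l₀, hl₀⟩, hLcl, hLT, hLadd, hLmin⟩ := exists_minimal_leftIdeal ⟨p, hp.1⟩ hcl hadd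
  intro s hs
  obtain ⟨l, hl, t, ht, rfl⟩ := hp.2 {q | ∃ l ∈ L, ∃ t ∈ T, l + t = q}
    ⟨⟨_, l₀, hl₀, p, hp.1, rfl⟩, by
      rintro _ ⟨l, hl, t, ht, rfl⟩
      exact hadd l (hLT hl) t ht, by
      rintro a ha _ ⟨l, hl, t, ht, rfl⟩
      exact ⟨a + l, hLadd a ha l hl, t, ht, add_assoc a l t⟩, by
      rintro a ha _ ⟨l, hl, t, ht, rfl⟩
      exact ⟨l, hl, t + a, hadd t ht a ha, (add_assoc l t a).symm⟩⟩
  obtain ⟨w, hw, hwl⟩ := hLmin (s + l) (hLadd s hs l hl) l hl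
  refine ⟨w, hw, ?_⟩
  rw [← add_assoc s, ← add_assoc w, hwl]

end UltrafilterSemigroup

section UltrafilterMap

variable {α β : Type}

lemma Ultrafilter.map_add_of_additive [Add α] [Add β] (f : α → β)
    (hf : ∀ x y, f (x + y) = f x + f y) (p q : Ultrafilter α) :
    (p + q).map f = p.map f + q.map f := by
  refine Ultrafilter.coe_inj.mp <| Filter.ext' fun P => ?_
  rw [Ultrafilter.eventually_add]
  simp only [Ultrafilter.coe_map, eventually_map]
  rw [Ultrafilter.eventually_add]
  simp only [hf]

lemma Ultrafilter.continuous_map (f : α → β) :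
    Continuous fun p : Ultrafilter α => p.map f :=
  ultrafilterBasis_is_basis.continuous_iff.2 <| Set.forall_mem_range.mpr fun s ↦
    ultrafilter_isOpen_basic (f ⁻¹' s)

lemma isClosed_setOf_ultrafilter_tendsto (f : α → β) (F : Filter β) :
    IsClosed {p : Ultrafilter α | Tendsto f p F} := by
  have : {p : Ultrafilter α | Tendsto f p F} = ⋂ A ∈ F, {p | f ⁻¹' A ∈ p} := by
    ext p
    simp [Tendsto, Filter.le_def]
  rw [this]
  exact isClosed_biInter fun A _ => ultrafilter_isClosed_basic _

lemma isClosed_setOf_ultrafilter_map_eq (f : α → β) (q : Ultrafilter β) :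
    IsClosed {p : Ultrafilter α | p.map f = q} :=
  isClosed_eq (Ultrafilter.continuous_map f) continuous_const

lemma Ultrafilter.tendsto_of_add [Add α] [Add β] {F : Filter β}
    (hF : Tendsto (fun x : β × β => x.1 + x.2) (F ×ˢ F) F) {f : α → β}
    (hf : ∀ x y, f (x + y) = f x + f y) {p q : Ultrafilter α} (hp : Tendsto f p F)
    (hq : Tendsto f q F) : Tendsto f (p + q : Ultrafilter α) F := by
  intro A hA
  have h := (hF.eventually hA).curry
  refine (Ultrafilter.eventually_add p q fun m => f m ∈ A).2 ?_
  filter_upwards [hp.eventually h] with x hx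
  filter_upwards [hq.eventually hx] with y hy
  rw [hf]
  exact hy

lemma Ultrafilter.add_pure_zero [AddZeroClass α] (p : Ultrafilter α) : p + pure 0 = p := by
  refine Ultrafilter.coe_inj.mp <| Filter.ext' fun P => ?_
  rw [Ultrafilter.eventually_add]
  simp

lemma Ultrafilter.pure_zero_add [AddZeroClass α] (p : Ultrafilter α) : pure 0 + p = p := by
  refine Ultrafilter.coe_inj.mp <| Filter.ext' fun P => ?_
  rw [Ultrafilter.eventually_add]
  simp

end UltrafilterMap

/-- The image of the nonnegative orthant under a linear map is closed, phrased along an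
ultrafilter. -/
lemma exists_nonneg_preimage_of_tendsto {ι : Type} {u v : ℕ} (U : Ultrafilter ι)
    (A : (Fin v → ℝ) →ₗ[ℝ] (Fin u → ℝ)) (b : Fin u → ℝ) (s : Finset (Fin v)) :
    ∀ z : ι → Fin v → ℝ, (∀ᶠ i in U, ∀ j, 0 ≤ z i j) → (∀ᶠ i in U, ∀ j ∉ s, z i j = 0) →
      Tendsto (fun i => A (z i)) U (nhds b) → ∃ g : Fin v → ℝ, (∀ j, 0 ≤ g j) ∧ A g = b := by
  have hA : Continuous A := A.continuous_of_finiteDimensional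
  induction s using Finset.strongInduction with
  | H s ih =>
  intro z hz hzs hlim
  by_cases hbdd : ∃ C, ∀ᶠ i in U, ‖z i‖ ≤ C
  · obtain ⟨C, hC⟩ := hbdd
    obtain ⟨g, -, hg⟩ := (isCompact_closedBall (0 : Fin v → ℝ) C).ultrafilter_le_nhds (U.map z)
      (by
        simp only [le_principal_iff, Ultrafilter.mem_coe, Ultrafilter.mem_map]
        filter_upwards [hC] with i hi
        simpa using hi)
    have hg : Tendsto z U (nhds g) := hg
    refine ⟨g, fun j => ?_, ?_⟩
    · exact ge_of_tendsto (tendsto_pi_nhds.1 hg j) (hz.mono fun i hi => hi j)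
    · exact tendsto_nhds_unique ((hA.tendsto g).comp hg) hlim
  · have htop : Tendsto (fun i => ‖z i‖) U atTop := by
      refine tendsto_atTop.2 fun C => ?_
      have h : ∀ᶠ i in U, ¬ ‖z i‖ ≤ C := Ultrafilter.eventually_not.2 fun h => hbdd ⟨C, h⟩
      exact h.mono fun i hi => (not_le.1 hi).le
    have hpos : ∀ᶠ i in U, 0 < ‖z i‖ := htop.eventually_gt_atTop 0
    obtain ⟨w, hwn, hw⟩ := (isCompact_sphere (0 : Fin v → ℝ) 1).ultrafilter_le_nhds
      (U.map fun i => ‖z i‖⁻¹ • z i)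
      (by
        simp only [le_principal_iff, Ultrafilter.mem_coe, Ultrafilter.mem_map]
        filter_upwards [hpos] with i hi
        simp [norm_smul, hi.ne'])
    have hw : Tendsto (fun i => ‖z i‖⁻¹ • z i) U (nhds w) := hw
    have hwj := tendsto_pi_nhds.1 hw
    have hw0 : ∀ j, 0 ≤ w j := fun j => ge_of_tendsto (hwj j) <| by
      filter_upwards [hz] with i hi
      exact mul_nonneg (inv_nonneg.2 (norm_nonneg _)) (hi j)
    have hws : ∀ j ∉ s, w j = 0 := fun j hj => tendsto_nhds_unique (hwj j) <| by
      refine tendsto_const_nhds.congr' ?_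
      filter_upwards [hzs] with i hi
      simp [hi j hj]
    have hAw : A w = 0 := by
      refine tendsto_nhds_unique ((hA.tendsto w).comp hw) ?_
      have := (tendsto_inv_atTop_zero.comp htop).smul hlim
      simpa [Function.comp_def] using this
    obtain ⟨j₁, hj₁⟩ : ∃ j, w j ≠ 0 := by
      by_contra! h
      have : w = 0 := funext h
      simp [this] at hwn
    let P : Finset (Fin v) := Finset.univ.filter fun j => 0 < w j
    have hP : P.Nonempty := ⟨j₁, by simpa [P] using lt_of_le_of_ne (hw0 j₁) hj₁.symm⟩
    have hmin : ∀ i, ∃ j ∈ P, ∀ k ∈ P, z i j / w j ≤ z i k / w k :=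
      fun i => P.exists_min_image (fun j => z i j / w j) hP
    choose J hJP hJ using hmin
    obtain ⟨j, hj⟩ := (U.map J).eq_pure_of_finite
    have hjU : ∀ᶠ i in U, J i = j := by
      have : ({j} : Set (Fin v)) ∈ U.map J := by rw [hj]; exact mem_singleton j
      exact this
    obtain ⟨i₀, hi₀⟩ := hjU.exists
    have hwjpos : 0 < w j := by
      have := hJP i₀
      rw [hi₀] at this
      simpa [P] using this
    have hjs : j ∈ s := by
      by_contra h
      exact hwjpos.ne' (hws j h)
    refine ih (s.erase j) (Finset.erase_ssubset hjs) (fun i => z i - (z i j / w j) • w) ?_ ?_ ?_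
    · filter_upwards [hz, hjU] with i hi hij k
      rcases (hw0 k).eq_or_lt with hk | hk
      · simpa [← hk] using hi k
      · have := hJ i k (by simpa [P] using hk)
        rw [hij, le_div_iff₀ hk] at this
        simpa using this
    · filter_upwards [hzs] with i hi k hk
      by_cases hkj : k = j
      · subst hkj
        simp [hwjpos.ne']
      · have hks : k ∉ s := fun h => hk (Finset.mem_erase.2 ⟨hkj, h⟩)
        simp [hi k hks, hws k hks]
    · simpa [hAw] using hlim

section LogColoring

variable {u v : ℕ} {M : Fin u → Fin v → ℝ}

/-- Two integers congruent modulo `m ^ 2` that are the floors of `m * a` and `m * b` force `a` and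
`b` to be either very close or far apart. -/
lemma abs_sub_lt_or_le_of_floor_emod_eq (n : ℕ) (a b : ℝ)
    (h : ⌊((n : ℝ) + 1) * a⌋ % ((n : ℤ) + 1) ^ 2 = ⌊((n : ℝ) + 1) * b⌋ % ((n : ℤ) + 1) ^ 2) :
    |a - b| < 1 / ((n : ℝ) + 1) ∨ (n : ℝ) ≤ |a - b| := by
  have hm : (0 : ℝ) < (n : ℝ) + 1 := by positivity
  have hmul : |((n : ℝ) + 1) * a - ((n : ℝ) + 1) * b| = ((n : ℝ) + 1) * |a - b| := by
    rw [← mul_sub, abs_mul, abs_of_pos hm]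
  by_cases hfl : ⌊((n : ℝ) + 1) * a⌋ = ⌊((n : ℝ) + 1) * b⌋
  · left
    have := Int.abs_sub_lt_one_of_floor_eq_floor hfl
    rw [hmul] at this
    rw [lt_div_iff₀ hm]
    linarith
  · right
    have hdvd : ((n : ℤ) + 1) ^ 2 ∣ ⌊((n : ℝ) + 1) * a⌋ - ⌊((n : ℝ) + 1) * b⌋ :=
      Int.ModEq.dvd (Int.ModEq.symm h)
    have hle : ((n : ℤ) + 1) ^ 2 ≤ |⌊((n : ℝ) + 1) * a⌋ - ⌊((n : ℝ) + 1) * b⌋| :=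
      Int.le_of_dvd (abs_pos.2 (sub_ne_zero.2 hfl)) ((dvd_abs _ _).2 hdvd)
    have hle' : ((n : ℝ) + 1) ^ 2 ≤
        |(⌊((n : ℝ) + 1) * a⌋ : ℝ) - (⌊((n : ℝ) + 1) * b⌋ : ℝ)| := by
      exact_mod_cast hle
    have hlt : |(⌊((n : ℝ) + 1) * a⌋ : ℝ) - (⌊((n : ℝ) + 1) * b⌋ : ℝ)| ≤
        |((n : ℝ) + 1) * a - ((n : ℝ) + 1) * b| + 1 := by
      have h1 := Int.floor_le (((n : ℝ) + 1) * a)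
      have h2 := Int.lt_floor_add_one (((n : ℝ) + 1) * a)
      have h3 := Int.floor_le (((n : ℝ) + 1) * b)
      have h4 := Int.lt_floor_add_one (((n : ℝ) + 1) * b)
      rw [abs_le]
      constructor
      · linarith [neg_abs_le (((n : ℝ) + 1) * a - ((n : ℝ) + 1) * b)]
      · linarith [le_abs_self (((n : ℝ) + 1) * a - ((n : ℝ) + 1) * b)]
    rw [hmul] at hlt
    have hn : (0 : ℝ) ≤ n := n.cast_nonneg
    by_contra hlt'
    nlinarith

lemma IPR.exists_log_close_or_far (hM : IPR M) (n : ℕ) : ∃ x : Fin v → Rpos,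
    (∀ k, 0 < ∑ j, M k j * (x j : ℝ)) ∧ ∀ k l,
      |Real.log (∑ j, M k j * (x j : ℝ)) - Real.log (∑ j, M l j * (x j : ℝ))| <
        1 / ((n : ℝ) + 1) ∨
      (n : ℝ) ≤ |Real.log (∑ j, M k j * (x j : ℝ)) - Real.log (∑ j, M l j * (x j : ℝ))| := by
  have hpos : (0 : ℤ) < ((n : ℤ) + 1) ^ 2 := by positivity
  have hbound : ∀ z : ℤ, (z % ((n : ℤ) + 1) ^ 2).toNat < (n + 1) ^ 2 := fun z => by
    rw [Int.toNat_lt (Int.emod_nonneg _ hpos.ne')]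
    exact_mod_cast Int.emod_lt_of_pos z hpos
  let c : Rpos → Fin ((n + 1) ^ 2) := fun y =>
    ⟨(⌊((n : ℝ) + 1) * Real.log (y : ℝ)⌋ % ((n : ℤ) + 1) ^ 2).toNat,
      hbound ⌊((n : ℝ) + 1) * Real.log (y : ℝ)⌋⟩
  obtain ⟨i, x, hx⟩ := hM ((n + 1) ^ 2) c
  refine ⟨x, fun k => (hx k).1, fun k l => ?_⟩
  obtain ⟨_, hk⟩ := hx k
  obtain ⟨_, hl⟩ := hx l
  have hkl := congrArg Fin.val (hk.trans hl.symm)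
  refine abs_sub_lt_or_le_of_floor_emod_eq n _ _ ?_
  have h1 := Int.emod_nonneg ⌊((n : ℝ) + 1) * Real.log (∑ j, M k j * (x j : ℝ))⌋ hpos.ne'
  have h2 := Int.emod_nonneg ⌊((n : ℝ) + 1) * Real.log (∑ j, M l j * (x j : ℝ))⌋ hpos.ne'
  rw [← Int.toNat_of_nonneg h1, ← Int.toNat_of_nonneg h2]
  exact congrArg Nat.cast hkl

/-- Along a nonprincipal ultrafilter, close-or-far logarithms make the ratio of two positive
sequences converge to `0`, `1` or infinity. -/
lemma tendsto_div_trichotomy {a b : ℕ → ℝ} (ha : ∀ n, 0 < a n) (hb : ∀ n, 0 < b n)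
    (h : ∀ n : ℕ, |Real.log (a n) - Real.log (b n)| < 1 / ((n : ℝ) + 1) ∨
      (n : ℝ) ≤ |Real.log (a n) - Real.log (b n)|) :
    Tendsto (fun n => a n / b n) (hyperfilter ℕ) (nhds 0) ∨
      Tendsto (fun n => a n / b n) (hyperfilter ℕ) (nhds 1) ∨
      Tendsto (fun n => b n / a n) (hyperfilter ℕ) (nhds 0) := by
  have hle : (hyperfilter ℕ : Filter ℕ) ≤ atTop := Nat.hyperfilter_le_atTop
  have hcast : Tendsto (fun n : ℕ => (n : ℝ)) (hyperfilter ℕ) atTop :=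
    tendsto_natCast_atTop_atTop.mono_left hle
  have hab : ∀ n, a n / b n = Real.exp (Real.log (a n) - Real.log (b n)) := fun n => by
    rw [Real.exp_sub, Real.exp_log (ha n), Real.exp_log (hb n)]
  have hba : ∀ n, b n / a n = Real.exp (Real.log (b n) - Real.log (a n)) := fun n => by
    rw [Real.exp_sub, Real.exp_log (ha n), Real.exp_log (hb n)]
  simp only [hab, hba]
  have hcases : ∀ᶠ n : ℕ in hyperfilter ℕ,
      |Real.log (a n) - Real.log (b n)| ≤ 1 / ((n : ℝ) + 1) ∨
      ((n : ℝ) ≤ Real.log (a n) - Real.log (b n) ∨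
        (n : ℝ) ≤ Real.log (b n) - Real.log (a n)) := by
    refine Eventually.of_forall fun n => (h n).imp le_of_lt fun hn => ?_
    rw [le_abs, neg_sub] at hn
    exact hn
  rw [Ultrafilter.eventually_or, Ultrafilter.eventually_or] at hcases
  rcases hcases with hc | hc | hc
  · right; left
    rw [← Real.exp_zero]
    refine (Real.continuous_exp.tendsto 0).comp ?_
    exact squeeze_zero_norm' hc (tendsto_one_div_add_atTop_nhds_zero_nat.mono_left hle)
  · right; right
    refine Real.tendsto_exp_atBot.comp ?_
    refine tendsto_atBot_mono' _ ?_ (tendsto_neg_atTop_atBot.comp hcast)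
    filter_upwards [hc] with n hn
    simp only [Function.comp_apply]
    linarith
  · left
    refine Real.tendsto_exp_atBot.comp ?_
    refine tendsto_atBot_mono' _ ?_ (tendsto_neg_atTop_atBot.comp hcast)
    filter_upwards [hc] with n hn
    simp only [Function.comp_apply]
    linarith

/-- Positive sequences whose pairwise ratios converge to `0`, `1` or infinity can be ranked by
their order of growth. -/
lemma exists_rank_of_tendsto_trichotomy {ι κ : Type} [Finite κ] {l : Filter ι} [l.NeBot]
    {y : κ → ι → ℝ} (hy : ∀ k i, 0 < y k i)
    (htri : ∀ k k', Tendsto (fun i => y k i / y k' i) l (nhds 0) ∨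
      Tendsto (fun i => y k i / y k' i) l (nhds 1) ∨
      Tendsto (fun i => y k' i / y k i) l (nhds 0)) :
    ∃ rank : κ → ℕ,
      (∀ k k', rank k < rank k' → Tendsto (fun i => y k i / y k' i) l (nhds 0)) ∧
      ∀ k k', rank k = rank k' → Tendsto (fun i => y k i / y k' i) l (nhds 1) := by
  have hmul : ∀ {k₁ k₂ k₃ : κ} {c d : ℝ}, Tendsto (fun i => y k₁ i / y k₂ i) l (nhds c) →
      Tendsto (fun i => y k₂ i / y k₃ i) l (nhds d) →
      Tendsto (fun i => y k₁ i / y k₃ i) l (nhds (c * d)) := by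
    intro k₁ k₂ k₃ c d h h'
    refine (h.mul h').congr fun i => ?_
    exact div_mul_div_cancel₀ (hy k₂ i).ne'
  have hself : ∀ k, Tendsto (fun i => y k i / y k i) l (nhds 1) := fun k =>
    tendsto_const_nhds.congr fun i => (div_self (hy k i).ne').symm
  have hirr : ∀ k, ¬ Tendsto (fun i => y k i / y k i) l (nhds 0) := fun k h =>
    zero_ne_one (tendsto_nhds_unique h (hself k))
  let rank : κ → ℕ := fun k => {k' | Tendsto (fun i => y k' i / y k i) l (nhds 0)}.ncard
  have hlt : ∀ k k', Tendsto (fun i => y k i / y k' i) l (nhds 0) → rank k < rank k' := by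
    intro k k' h
    refine ncard_lt_ncard ?_ (toFinite _)
    refine ⟨fun k'' h'' => ?_, fun hsub => hirr k (hsub h)⟩
    simpa using hmul h'' h
  have heq : ∀ k k', Tendsto (fun i => y k i / y k' i) l (nhds 1) → rank k = rank k' := by
    intro k k' h
    have h' : Tendsto (fun i => y k' i / y k i) l (nhds 1) := by
      simpa using h.inv₀ one_ne_zero
    have : {k'' | Tendsto (fun i => y k'' i / y k i) l (nhds 0)} =
        {k'' | Tendsto (fun i => y k'' i / y k' i) l (nhds 0)} := by
      ext k''
      exact ⟨fun h'' => by simpa using hmul h'' h, fun h'' => by simpa using hmul h'' h'⟩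
    exact congrArg ncard this
  refine ⟨rank, fun k k' hr => ?_, fun k k' hr => ?_⟩
  · rcases htri k k' with h | h | h
    · exact h
    · exact absurd (heq k k' h) hr.ne
    · exact absurd (hlt k' k h) hr.asymm
  · rcases htri k k' with h | h | h
    · exact absurd hr (hlt k k' h).ne
    · exact h
    · exact absurd hr.symm (hlt k' k h).ne

/-- The algebraic content of image partition regularity: the rows can be layered so that each
layer is hit by a nonnegative vector annihilated by all lower layers. -/
lemma IPR.exists_rank (hM : IPR M) : ∃ rank : Fin u → ℕ, ∀ n, ∃ g : Fin v → ℝ,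
    (∀ j, 0 ≤ g j) ∧ (∀ k, rank k < n → ∑ j, M k j * g j = 0) ∧
      ∀ k, rank k = n → ∑ j, M k j * g j = 1 := by
  choose x hx hlog using hM.exists_log_close_or_far
  obtain ⟨rank, hlt, heq⟩ := exists_rank_of_tendsto_trichotomy (l := (hyperfilter ℕ : Filter ℕ))
    (y := fun k n => ∑ j, M k j * (x n j : ℝ)) (fun k n => hx n k)
    (fun k k' => tendsto_div_trichotomy (fun n => hx n k) (fun n => hx n k')
      fun n => hlog n k k')
  refine ⟨rank, fun n => ?_⟩
  by_cases hn : ∃ k₀, rank k₀ = n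
  · obtain ⟨k₀, rfl⟩ := hn
    obtain ⟨g, hg0, hg⟩ := exists_nonneg_preimage_of_tendsto (hyperfilter ℕ)
      (Matrix.mulVecLin (Matrix.of fun k j => if rank k ≤ rank k₀ then M k j else 0))
      (fun k => if rank k = rank k₀ then 1 else 0) Finset.univ
      (fun n j => (x n j : ℝ) / ∑ j, M k₀ j * (x n j : ℝ))
      (Eventually.of_forall fun n j => (div_pos (x n j).2 (hx n k₀)).le)
      (Eventually.of_forall fun n j hj => absurd (Finset.mem_univ j) hj)
      (by
        refine tendsto_pi_nhds.2 fun k => ?_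
        have hrow : ∀ n, (∑ j, M k j * (x n j : ℝ)) / ∑ j, M k₀ j * (x n j : ℝ) =
            ∑ j, M k j * ((x n j : ℝ) / ∑ j, M k₀ j * (x n j : ℝ)) := fun n => by
          rw [Finset.sum_div]
          exact Finset.sum_congr rfl fun j _ => mul_div_assoc _ _ _
        rcases lt_trichotomy (rank k) (rank k₀) with h | h | h
        · simpa [Matrix.mulVec, dotProduct, h.le, h.ne, hrow] using hlt k k₀ h
        · simpa [Matrix.mulVec, dotProduct, h.le, h, hrow] using heq k k₀ h
        · simp [Matrix.mulVec, dotProduct, h.not_ge, h.ne'])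
    refine ⟨g, hg0, fun k hk => ?_, fun k hk => ?_⟩
    · simpa [Matrix.mulVec, dotProduct, hk.le, hk.ne] using congrFun hg k
    · simpa [Matrix.mulVec, dotProduct, hk.le, hk] using congrFun hg k
  · exact ⟨0, fun j => le_rfl, by simp, fun k hk => absurd ⟨k, hk⟩ hn⟩

end LogColoring

section Lifting

variable {u v : ℕ} {M : Fin u → Fin v → ℝ} {F : Filter ℝ}

lemma tendsto_sum_mul_of_pos (hFadd : Tendsto (fun x : ℝ × ℝ => x.1 + x.2) (F ×ˢ F) F)
    (hFmul : ∀ c : ℝ, 0 < c → Tendsto (fun x => c * x) F F) (hv : 1 ≤ v)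
    {q : Filter (Fin v → ℝ)} (hq : ∀ j, Tendsto (fun x => x j) q F)
    {d : Fin v → ℝ} (hd : ∀ j, 0 < d j) : Tendsto (fun x => ∑ j, d j * x j) q F := by
  have key : ∀ s : Finset (Fin v), s.Nonempty →
      Tendsto (fun x : Fin v → ℝ => ∑ j ∈ s, d j * x j) q F := by
    intro s hs
    induction hs using Finset.Nonempty.cons_induction with
    | singleton a => simpa [Function.comp_def] using (hFmul _ (hd a)).comp (hq a)
    | cons a s ha hs ih =>
      simp only [Finset.sum_cons]
      exact hFadd.comp (((hFmul _ (hd a)).comp (hq a)).prodMk ih)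
  exact key _ ⟨⟨0, hv⟩, Finset.mem_univ _⟩

lemma sum_mul_add (c x y : Fin v → ℝ) :
    ∑ j, c j * (x + y) j = ∑ j, c j * x j + ∑ j, c j * y j := by
  simp [mul_add, Finset.sum_add_distrib]

/-- If `p` is a minimal idempotent and the rows of `M` in `R` all send the idempotent `q` to `p`,
then `q` can be modified along a nonnegative vector `g` killed by the rows in `R` so that the rows
taking the value `1` at `g` send it to `p` as well. -/
lemma exists_idempotent_extend (hFadd : Tendsto (fun x : ℝ × ℝ => x.1 + x.2) (F ×ˢ F) F)
    (hFmul : ∀ c : ℝ, 0 < c → Tendsto (fun x => c * x) F F) (hv : 1 ≤ v)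
    {p : Ultrafilter ℝ} (hpF : Tendsto id (p : Filter ℝ) F) (hp : p + p = p)
    (hmin : ∀ s : Ultrafilter ℝ, Tendsto id (s : Filter ℝ) F →
      ∃ w : Ultrafilter ℝ, w + (s + p) = p)
    {q : Ultrafilter (Fin v → ℝ)} (hq : q + q = q)
    (hqF : ∀ j, Tendsto (fun x : Fin v → ℝ => x j) q F) {R R' : Set (Fin u)}
    (hqR : ∀ k ∈ R, q.map (fun x => ∑ j, M k j * x j) = p) {g : Fin v → ℝ}
    (hg0 : ∀ j, 0 ≤ g j) (hgR : ∀ k ∈ R, ∑ j, M k j * g j = 0)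
    (hgR' : ∀ k ∈ R', ∑ j, M k j * g j = 1) :
    ∃ q' : Ultrafilter (Fin v → ℝ), q' + q' = q' ∧
      (∀ j, Tendsto (fun x : Fin v → ℝ => x j) q' F) ∧
      ∀ k ∈ R ∪ R', q'.map (fun x => ∑ j, M k j * x j) = p := by
  let φ : Fin u → ℝ × (Fin v → ℝ) → ℝ := fun k w => w.1 + ∑ j, M k j * w.2 j
  have hφ : ∀ k w w', φ k (w + w') = φ k w + φ k w' := fun k w w' => by
    simp only [φ, Prod.fst_add, Prod.snd_add, sum_mul_add]
    ring
  have hfst : ∀ w w' : ℝ × (Fin v → ℝ), (w + w').1 = w.1 + w'.1 := fun _ _ => rfl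
  have hsnd : ∀ w w' : ℝ × (Fin v → ℝ), (w + w').2 = w.2 + w'.2 := fun _ _ => rfl
  let X : Set (Ultrafilter (ℝ × (Fin v → ℝ))) :=
    {Q | Q.map Prod.snd = q ∧ Tendsto Prod.fst (Q : Filter (ℝ × (Fin v → ℝ))) F ∧
      ∀ k, Tendsto (φ k) Q F}
  have hXcl : IsClosed X := by
    have : X = {Q : Ultrafilter (ℝ × (Fin v → ℝ)) | Q.map Prod.snd = q} ∩
        ({Q : Ultrafilter (ℝ × (Fin v → ℝ)) | Tendsto Prod.fst (Q : Filter (ℝ × (Fin v → ℝ))) F} ∩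
          ⋂ k, {Q : Ultrafilter (ℝ × (Fin v → ℝ)) | Tendsto (φ k) (Q : Filter (ℝ × (Fin v → ℝ))) F}) := by
      ext Q
      simp [X]
    rw [this]
    exact (isClosed_setOf_ultrafilter_map_eq _ _).inter
      ((isClosed_setOf_ultrafilter_tendsto _ _).inter
        (isClosed_iInter fun k => isClosed_setOf_ultrafilter_tendsto _ _))
  have hXadd : ∀ a ∈ X, ∀ b ∈ X, a + b ∈ X := fun a ha b hb =>
    ⟨by rw [Ultrafilter.map_add_of_additive _ hsnd, ha.1, hb.1, hq],
      Ultrafilter.tendsto_of_add hFadd hfst ha.2.1 hb.2.1,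
      fun k => Ultrafilter.tendsto_of_add hFadd (hφ k) (ha.2.2 k) (hb.2.2 k)⟩
  have hXne : X.Nonempty := by
    let c : ℝ := 1 + ∑ k, ∑ j, |M k j|
    have hcM : ∀ k j, |M k j| < c := fun k j => by
      have h1 : |M k j| ≤ ∑ j, |M k j| :=
        Finset.single_le_sum (f := fun j => |M k j|) (fun _ _ => abs_nonneg _)
          (Finset.mem_univ j)
      have h2 : ∑ j, |M k j| ≤ ∑ k, ∑ j, |M k j| :=
        Finset.single_le_sum (f := fun k => ∑ j, |M k j|)
          (fun _ _ => Finset.sum_nonneg fun _ _ => abs_nonneg _) (Finset.mem_univ k)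
      simp only [c]
      linarith
    have hc : 0 < c := by positivity
    refine ⟨q.map fun x => (∑ j, c * x j, x), ?_, ?_, fun k => ?_⟩
    · rw [Ultrafilter.map_map]
      exact Ultrafilter.map_id' q
    · exact tendsto_map'_iff.2 (tendsto_sum_mul_of_pos hFadd hFmul hv hqF fun _ => hc)
    · refine tendsto_map'_iff.2 ?_
      refine (tendsto_sum_mul_of_pos hFadd hFmul hv hqF (d := fun j => c + M k j)
        fun j => ?_).congr fun x => ?_
      · linarith [hcM k j, neg_abs_le (M k j)]
      · simp [φ, add_mul, Finset.sum_add_distrib]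
  let P : Ultrafilter (ℝ × (Fin v → ℝ)) := p.map fun a => (a, 0)
  have hPsnd : P.map Prod.snd = pure 0 := by
    rw [Ultrafilter.map_map]
    exact Ultrafilter.coe_inj.1 (by simp [Function.comp_def, Filter.map_const])
  have hPfst : Tendsto Prod.fst (P : Filter (ℝ × (Fin v → ℝ))) F := tendsto_map'_iff.2 hpF
  have hPφ : ∀ k, P.map (φ k) = p := fun k => by
    rw [Ultrafilter.map_map]
    simp [Function.comp_def, φ]
  have hPφF : ∀ k, Tendsto (φ k) P F := fun k => by
    have := congrArg (fun r : Ultrafilter ℝ => (r : Filter ℝ)) (hPφ k)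
    simp only [Ultrafilter.coe_map] at this
    rw [Tendsto, this]
    exact hpF
  have hXP : ∀ a ∈ X, a + P ∈ X := fun a ha =>
    ⟨by rw [Ultrafilter.map_add_of_additive _ hsnd, ha.1, hPsnd, Ultrafilter.add_pure_zero],
      Ultrafilter.tendsto_of_add hFadd hfst ha.2.1 hPfst,
      fun k => Ultrafilter.tendsto_of_add hFadd (hφ k) (ha.2.2 k) (hPφF k)⟩
  have hPX : ∀ a ∈ X, P + a ∈ X := fun a ha =>
    ⟨by rw [Ultrafilter.map_add_of_additive _ hsnd, ha.1, hPsnd, Ultrafilter.pure_zero_add],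
      Ultrafilter.tendsto_of_add hFadd hfst hPfst ha.2.1,
      fun k => Ultrafilter.tendsto_of_add hFadd (hφ k) (hPφF k) (ha.2.2 k)⟩
  obtain ⟨_, ⟨E, hEX, rfl⟩, hE⟩ := exists_idempotent_of_isClosed (X := (· + P) '' X)
    (hXne.image _) (hXcl.isCompact.image (Ultrafilter.continuous_add_left P)).isClosed (by
      rintro _ ⟨a, ha, rfl⟩ _ ⟨b, hb, rfl⟩
      exact ⟨a + P + b, hXadd _ (hXP a ha) b hb, add_assoc (a + P) b P⟩)
  have hpe : ∀ k, (P + (E + P)).map (φ k) = p := fun k => by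
    have hadd := Ultrafilter.map_add_of_additive _ (hφ k)
    obtain ⟨w, hw⟩ := hmin (E.map (φ k)) (tendsto_map'_iff.2 (hEX.2.2 k))
    have hidem := congrArg (Ultrafilter.map (φ k)) hE
    simp only [hadd, hPφ] at hidem ⊢
    calc p + (E.map (φ k) + p) = w + (E.map (φ k) + p) + (E.map (φ k) + p) := by rw [hw]
      _ = w + ((E.map (φ k) + p) + (E.map (φ k) + p)) := add_assoc _ _ _
      _ = p := by rw [hidem, hw]
  obtain ⟨Q, ⟨hQX, hQp⟩, hQ⟩ := exists_idempotent_of_isClosed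
    (X := X ∩ ⋂ k, {Q | Q.map (φ k) = p})
    ⟨P + (E + P), hPX _ (hXP E hEX), mem_iInter.2 hpe⟩
    (hXcl.inter (isClosed_iInter fun k => isClosed_setOf_ultrafilter_map_eq _ _))
    (fun a ha b hb => ⟨hXadd a ha.1 b hb.1, mem_iInter.2 fun k => by
      have h1 : a.map (φ k) = p := mem_iInter.1 ha.2 k
      have h2 : b.map (φ k) = p := mem_iInter.1 hb.2 k
      simp only [mem_ofPred_eq, Ultrafilter.map_add_of_additive _ (hφ k), h1, h2, hp]⟩)
  let ψ : ℝ × (Fin v → ℝ) → Fin v → ℝ := fun w => w.2 + w.1 • g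
  have hψ : ∀ w w', ψ (w + w') = ψ w + ψ w' := fun w w' => by
    simp only [ψ, Prod.fst_add, Prod.snd_add, add_smul]
    abel
  have hrow : ∀ k w, ∑ j, M k j * ψ w j =
      ∑ j, M k j * w.2 j + w.1 * ∑ j, M k j * g j := fun k w => by
    rw [sum_mul_add, Finset.mul_sum]
    congr 1
    exact Finset.sum_congr rfl fun j _ => by simp [mul_left_comm]
  refine ⟨Q.map ψ, ?_, fun j => tendsto_map'_iff.2 ?_, fun k hk => ?_⟩
  · rw [← Ultrafilter.map_add_of_additive _ hψ, hQ]
  · have hx : Tendsto (fun w : ℝ × (Fin v → ℝ) => w.2 j) Q F := by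
      have := hqF j
      rw [← hQX.1] at this
      exact tendsto_map'_iff.1 this
    rcases (hg0 j).eq_or_lt with hj | hj
    · simpa [Function.comp_def, ψ, ← hj] using hx
    · have := hFadd.comp (hx.prodMk ((hFmul _ hj).comp hQX.2.1))
      simpa [Function.comp_def, ψ, mul_comm] using this
  · rw [Ultrafilter.map_map]
    rcases hk with hk | hk
    · rw [← hqR k hk, ← hQX.1, Ultrafilter.map_map]
      congr 1
      funext w
      simp [hrow, hgR k hk]
    · rw [← (mem_iInter.1 hQp k : Q.map (φ k) = p)]
      congr 1
      funext w
      simp [hrow, hgR' k hk, φ, add_comm]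

/-- An image partition regular matrix has a common preimage of every minimal idempotent. -/
lemma IPR.exists_ultrafilter_map_eq (hM : IPR M)
    (hFadd : Tendsto (fun x : ℝ × ℝ => x.1 + x.2) (F ×ˢ F) F)
    (hFmul : ∀ c : ℝ, 0 < c → Tendsto (fun x => c * x) F F) (hv : 1 ≤ v)
    {p : Ultrafilter ℝ} (hpF : Tendsto id (p : Filter ℝ) F) (hp : p + p = p)
    (hmin : ∀ s : Ultrafilter ℝ, Tendsto id (s : Filter ℝ) F →
      ∃ w : Ultrafilter ℝ, w + (s + p) = p) :
    ∃ q : Ultrafilter (Fin v → ℝ), (∀ j, Tendsto (fun x : Fin v → ℝ => x j) q F) ∧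
      ∀ k, q.map (fun x => ∑ j, M k j * x j) = p := by
  obtain ⟨rank, hrank⟩ := hM.exists_rank
  have key : ∀ n : ℕ, ∃ q : Ultrafilter (Fin v → ℝ), q + q = q ∧
      (∀ j, Tendsto (fun x : Fin v → ℝ => x j) q F) ∧
      ∀ k ∈ {k | rank k < n}, q.map (fun x => ∑ j, M k j * x j) = p := by
    intro n
    induction n with
    | zero =>
      refine ⟨p.map fun a _ => a, ?_, fun j => tendsto_map'_iff.2 hpF, by simp⟩
      rw [← Ultrafilter.map_add_of_additive (fun (a : ℝ) (_ : Fin v) => a) fun _ _ => rfl, hp]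
    | succ n ih =>
      obtain ⟨q, hq, hqF, hqR⟩ := ih
      obtain ⟨g, hg0, hgR, hgR'⟩ := hrank n
      obtain ⟨q', hq', hqF', hqR'⟩ := exists_idempotent_extend hFadd hFmul hv hpF hp hmin hq hqF
        hqR hg0 hgR (R' := {k | rank k = n}) hgR'
      exact ⟨q', hq', hqF', fun k hk => hqR' k (Nat.lt_succ_iff_lt_or_eq.1 hk)⟩
  obtain ⟨q, -, hqF, hqR⟩ := key (Finset.univ.sup rank + 1)
  exact ⟨q, hqF, fun k => hqR k (Nat.lt_succ_of_le (Finset.le_sup (Finset.mem_univ k)))⟩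

end Lifting

section CentralSets

variable {u v : ℕ} {M : Fin u → Fin v → ℝ} {F : Filter ℝ} {T : Set (Ultrafilter Rpos)}

lemma isClosed_of_mem_iff_tendsto
    (hT : ∀ p, p ∈ T ↔ Tendsto Subtype.val (p : Filter Rpos) F) : IsClosed T := by
  have : T = {p : Ultrafilter Rpos | Tendsto Subtype.val (p : Filter Rpos) F} := Set.ext hT
  rw [this]
  exact isClosed_setOf_ultrafilter_tendsto _ _

lemma add_mem_of_mem_iff_tendsto (hFadd : Tendsto (fun x : ℝ × ℝ => x.1 + x.2) (F ×ˢ F) F)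
    (hT : ∀ p, p ∈ T ↔ Tendsto Subtype.val (p : Filter Rpos) F) :
    ∀ a ∈ T, ∀ b ∈ T, a + b ∈ T := fun a ha b hb =>
  (hT _).2 (Ultrafilter.tendsto_of_add hFadd (fun _ _ => rfl) ((hT a).1 ha) ((hT b).1 hb))

/-- Every member of a minimal idempotent of the semigroup of ultrafilters finer than `F` contains
an image of an image partition regular matrix, with entries of the argument in a given member
of `F`. -/
lemma IPR.exists_image_mem (hM : IPR M) (hv : 1 ≤ v)
    (hFadd : Tendsto (fun x : ℝ × ℝ => x.1 + x.2) (F ×ˢ F) F)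
    (hFmul : ∀ c : ℝ, 0 < c → Tendsto (fun x => c * x) F F) (hFpos : Ioi 0 ∈ F)
    (hT : ∀ p, p ∈ T ↔ Tendsto Subtype.val (p : Filter Rpos) F)
    {p : Ultrafilter Rpos} (hp : p + p = p) (hpK : memK T p) {C B : Set ℝ}
    (hC : {x : Rpos | (x : ℝ) ∈ C} ∈ p) (hB : B ∈ F) :
    ∃ x : Fin v → Rpos, (∀ j, (x j : ℝ) ∈ B) ∧ ∀ k, ∑ j, M k j * (x j : ℝ) ∈ C := by
  have hval : ∀ x y : Rpos, ((x + y : Rpos) : ℝ) = x + y := fun _ _ => rfl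
  obtain ⟨q, hqF, hq⟩ := hM.exists_ultrafilter_map_eq hFadd hFmul hv
    (p := p.map Subtype.val) (tendsto_map'_iff.2 ((hT p).1 hpK.1))
    (by rw [← Ultrafilter.map_add_of_additive _ hval, hp])
    (fun s hs => by
      have hrange : range (Subtype.val : Rpos → ℝ) ∈ s := by
        filter_upwards [hs hFpos] with x hx using ⟨⟨x, hx⟩, rfl⟩
      let s' : Ultrafilter Rpos := s.comap Subtype.val_injective hrange
      have hs' : s'.map Subtype.val = s := Ultrafilter.coe_inj.1 <| by
        simp only [s', Ultrafilter.coe_map, Ultrafilter.coe_comap]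
        exact map_comap_of_mem hrange
      obtain ⟨w, -, hw⟩ := hpK.exists_add_add_eq (isClosed_of_mem_iff_tendsto hT)
        (add_mem_of_mem_iff_tendsto hFadd hT) s' ((hT s').2 (by
          rw [← hs'] at hs
          exact tendsto_map'_iff.1 hs))
      refine ⟨w.map Subtype.val, ?_⟩
      rw [← hs', ← Ultrafilter.map_add_of_additive _ hval,
        ← Ultrafilter.map_add_of_additive _ hval, hw])
  have h1 : ∀ᶠ x in (q : Filter (Fin v → ℝ)), ∀ j, x j ∈ B ∩ Ioi 0 :=
    eventually_all.2 fun j => hqF j (inter_mem hB hFpos)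
  have h2 : ∀ᶠ x in (q : Filter (Fin v → ℝ)), ∀ k, ∑ j, M k j * x j ∈ C := eventually_all.2 fun k => by
    have : C ∈ q.map (fun x => ∑ j, M k j * x j) := by
      rw [hq k]
      exact hC
    exact this
  obtain ⟨x, hxB, hxC⟩ := (h1.and h2).exists
  exact ⟨fun j => ⟨x j, (hxB j).2⟩, fun j => (hxB j).1, hxC⟩

lemma exists_color_mem {r : ℕ} (c : Rpos → Fin r) (p : Ultrafilter Rpos) :
    ∃ i, {y | c y = i} ∈ p := by
  obtain ⟨i, hi⟩ := (p.map c).eq_pure_of_finite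
  have : ({i} : Set (Fin r)) ∈ p.map c := by
    rw [hi]
    exact mem_singleton i
  exact ⟨i, this⟩

lemma mem_univ_iff_tendsto_val (p : Ultrafilter Rpos) :
    p ∈ univ ↔ Tendsto Subtype.val (p : Filter Rpos) (𝓟 (Ioi (0 : ℝ))) := by
  simp only [mem_univ, tendsto_principal, true_iff]
  exact Eventually.of_forall fun x => x.2

lemma mem_zeroPlus1_iff_tendsto_val (p : Ultrafilter Rpos) :
    p ∈ zeroPlus1 ↔ Tendsto Subtype.val (p : Filter Rpos) (nhdsWithin 0 (Ioi (0 : ℝ))) := by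
  rw [(nhdsGT_basis (0 : ℝ)).tendsto_right_iff]
  refine forall₂_congr fun ε _ => ?_
  have : {x : Rpos | (x : ℝ) < ε} = {x : Rpos | (x : ℝ) ∈ Ioo 0 ε} := by
    ext x
    exact ⟨fun h => ⟨x.2, h⟩, fun h => h.2⟩
  rw [this]
  rfl

lemma tendsto_add_principal_Ioi : Tendsto (fun x : ℝ × ℝ => x.1 + x.2)
    (𝓟 (Ioi 0) ×ˢ 𝓟 (Ioi 0)) (𝓟 (Ioi 0)) := by
  rw [prod_principal_principal, tendsto_principal_principal]
  exact fun x hx => add_pos (mem_Ioi.1 hx.1) (mem_Ioi.1 hx.2)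

lemma tendsto_mul_principal_Ioi (c : ℝ) (hc : 0 < c) :
    Tendsto (fun x => c * x) (𝓟 (Ioi 0)) (𝓟 (Ioi 0)) := by
  rw [tendsto_principal_principal]
  exact fun x hx => mul_pos hc hx

lemma tendsto_add_nhdsGT_zero : Tendsto (fun x : ℝ × ℝ => x.1 + x.2)
    (nhdsWithin 0 (Ioi 0) ×ˢ nhdsWithin 0 (Ioi 0)) (nhdsWithin 0 (Ioi 0)) := by
  refine tendsto_nhdsWithin_iff.2 ⟨?_, ?_⟩
  · have h := (continuous_add (M := ℝ)).tendsto (0, 0)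
    rw [nhds_prod_eq, add_zero] at h
    exact h.mono_left (prod_mono nhdsWithin_le_nhds nhdsWithin_le_nhds)
  · filter_upwards [prod_mem_prod self_mem_nhdsWithin self_mem_nhdsWithin] with x hx
    exact add_pos (mem_Ioi.1 hx.1) (mem_Ioi.1 hx.2)

lemma tendsto_mul_nhdsGT_zero (c : ℝ) (hc : 0 < c) :
    Tendsto (fun x => c * x) (nhdsWithin 0 (Ioi 0)) (nhdsWithin 0 (Ioi 0)) := by
  refine tendsto_nhdsWithin_iff.2 ⟨?_, ?_⟩
  · have h := (continuous_const_mul c).tendsto 0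
    rw [mul_zero] at h
    exact h.mono_left nhdsWithin_le_nhds
  · filter_upwards [self_mem_nhdsWithin] with x hx
    exact mul_pos hc hx

lemma zeroPlus1_nonempty : zeroPlus1.Nonempty := by
  have hne : (comap (Subtype.val : Rpos → ℝ) (nhdsWithin 0 (Ioi 0))).NeBot := by
    refine NeBot.comap_of_range_mem inferInstance ?_
    filter_upwards [self_mem_nhdsWithin] with x hx using ⟨⟨x, hx⟩, rfl⟩
  refine ⟨Ultrafilter.of (comap Subtype.val (nhdsWithin 0 (Ioi 0))), ?_⟩
  exact (mem_zeroPlus1_iff_tendsto_val _).2 (tendsto_comap.mono_left (Ultrafilter.of_le _))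

lemma IPRNearZero.ipr (h : IPRNearZero M) : IPR M := fun r c => by
  obtain ⟨i, x, hx⟩ := h r c 1 one_pos
  exact ⟨i, x, fun k => ⟨(hx k).1, (hx k).2.2⟩⟩

lemma ipr_of_central (h : ∀ C : Set ℝ, C ⊆ Ioi 0 → Central C →
    ∃ x : Fin v → Rpos, ∀ k : Fin u, (∑ j, M k j * (x j : ℝ)) ∈ C) : IPR M := fun r c => by
  obtain ⟨p, hp, hpK⟩ := exists_idempotent_memK (T := (univ : Set (Ultrafilter Rpos)))
    ⟨pure ⟨1, one_pos⟩, mem_univ _⟩ isClosed_univ fun _ _ _ _ => mem_univ _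
  obtain ⟨i, hi⟩ := exists_color_mem c p
  obtain ⟨x, hx⟩ := h (Subtype.val '' {y : Rpos | c y = i})
    (by rintro _ ⟨y, -, rfl⟩; exact y.2)
    ⟨p, hp, hpK, by filter_upwards [hi] with y hy using ⟨y, hy, rfl⟩⟩
  refine ⟨i, x, fun k => ?_⟩
  obtain ⟨y, hy, hyx⟩ := hx k
  simp only [← hyx]
  exact ⟨y.2, hy⟩

lemma iprNearZero_of_centralNearZero (h : ∀ C : Set ℝ, C ⊆ Ioi 0 → CentralNearZero C →
    ∃ x : Fin v → Rpos, ∀ k : Fin u, (∑ j, M k j * (x j : ℝ)) ∈ C) : IPRNearZero M := by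
  intro r c δ hδ
  obtain ⟨p, hp, hpK⟩ := exists_idempotent_memK zeroPlus1_nonempty
    (isClosed_of_mem_iff_tendsto mem_zeroPlus1_iff_tendsto_val)
    (add_mem_of_mem_iff_tendsto tendsto_add_nhdsGT_zero mem_zeroPlus1_iff_tendsto_val)
  obtain ⟨i, hi⟩ := exists_color_mem c p
  obtain ⟨x, hx⟩ := h (Subtype.val '' ({y : Rpos | c y = i} ∩ {y : Rpos | (y : ℝ) < δ}))
    (by rintro _ ⟨y, -, rfl⟩; exact y.2)
    ⟨p, hp, hpK, by
      filter_upwards [hi, hpK.1 δ hδ] with y hy hyδ using ⟨y, ⟨hy, hyδ⟩, rfl⟩⟩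
  refine ⟨i, x, fun k => ?_⟩
  obtain ⟨y, hy, hyx⟩ := hx k
  simp only [← hyx]
  exact ⟨y.2, hy.2, hy.1⟩

lemma IPR.exists_image_mem_of_central (hM : IPR M) (hv : 1 ≤ v) {C : Set ℝ} (hC : Central C) :
    ∃ x : Fin v → Rpos, ∀ k : Fin u, (∑ j, M k j * (x j : ℝ)) ∈ C := by
  obtain ⟨p, hp, hpK, hCp⟩ := hC
  obtain ⟨x, -, hx⟩ := hM.exists_image_mem hv tendsto_add_principal_Ioi
    tendsto_mul_principal_Ioi (mem_principal_self _) mem_univ_iff_tendsto_val hp hpK hCp univ_mem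
  exact ⟨x, hx⟩

lemma IPR.exists_image_mem_of_centralNearZero (hM : IPR M) (hv : 1 ≤ v) {C : Set ℝ}
    (hC : CentralNearZero C) {ε : ℝ} (hε : 0 < ε) :
    ∃ x : Fin v → Rpos, (∀ j, (x j : ℝ) < ε) ∧
      ∀ k : Fin u, (∑ j, M k j * (x j : ℝ)) ∈ C := by
  obtain ⟨p, hp, hpK, hCp⟩ := hC
  exact hM.exists_image_mem hv tendsto_add_nhdsGT_zero tendsto_mul_nhdsGT_zero
    self_mem_nhdsWithin mem_zeroPlus1_iff_tendsto_val hp hpK hCp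
    (mem_nhdsWithin_of_mem_nhds (Iio_mem_nhds hε))

end CentralSets

/-- For a `u × v` matrix `M` with real entries, the following are equivalent:
(1) `M` is IPR/ℝ⁺; (2) `M` is IPR near zero over `ℝ⁺`; (3) every central set in `ℝ⁺`
contains the entries of `M·x` for some `x ∈ (ℝ⁺)^v`; (4) the same for every central set
near zero; (5) for every central set near zero `C` and every `ε > 0` there is
`x ∈ (0,ε)^v` with `M·x ∈ C^u`. -/
theorem ipr_iff_iprNearZero_iff_central {u v : ℕ} (hu : 1 ≤ u) (hv : 1 ≤ v)
    (M : Fin u → Fin v → ℝ) :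
    (IPR M ↔ IPRNearZero M) ∧
    (IPR M ↔ ∀ C : Set ℝ, C ⊆ Set.Ioi 0 → Central C →
      ∃ x : Fin v → Rpos, ∀ k : Fin u, (∑ j, M k j * (x j : ℝ)) ∈ C) ∧
    (IPR M ↔ ∀ C : Set ℝ, C ⊆ Set.Ioi 0 → CentralNearZero C →
      ∃ x : Fin v → Rpos, ∀ k : Fin u, (∑ j, M k j * (x j : ℝ)) ∈ C) ∧
    (IPR M ↔ ∀ C : Set ℝ, C ⊆ Set.Ioi 0 → CentralNearZero C → ∀ ε : ℝ, 0 < ε →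
      ∃ x : Fin v → Rpos, (∀ j, (x j : ℝ) < ε) ∧
        ∀ k : Fin u, (∑ j, M k j * (x j : ℝ)) ∈ C) := by
  have h15 : IPR M → ∀ C : Set ℝ, C ⊆ Set.Ioi 0 → CentralNearZero C → ∀ ε : ℝ, 0 < ε →
      ∃ x : Fin v → Rpos, (∀ j, (x j : ℝ) < ε) ∧
        ∀ k : Fin u, (∑ j, M k j * (x j : ℝ)) ∈ C :=
    fun h C _ hC ε hε => h.exists_image_mem_of_centralNearZero hv hC hε
  have h14 : IPR M → ∀ C : Set ℝ, C ⊆ Set.Ioi 0 → CentralNearZero C →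
      ∃ x : Fin v → Rpos, ∀ k : Fin u, (∑ j, M k j * (x j : ℝ)) ∈ C :=
    fun h C hC₀ hC => (h15 h C hC₀ hC 1 one_pos).imp fun _ hx => hx.2
  refine ⟨⟨fun h => iprNearZero_of_centralNearZero (h14 h), IPRNearZero.ipr⟩,
    ⟨fun h C _ hC => h.exists_image_mem_of_central hv hC, ipr_of_central⟩,
    ⟨h14, fun h => (iprNearZero_of_centralNearZero h).ipr⟩,
    ⟨h15, fun h => (iprNearZero_of_centralNearZero fun C hC₀ hC =>
      (h C hC₀ hC 1 one_pos).imp fun _ hx => hx.2).ipr⟩⟩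
end

section
/- Let u, v ∈ ℕ and let M be a u × v matrix with entries from ℝ⁺ ∪ {0} with no row equal to the zero row. Let p be an idempotent in 0⁺(ℝ⁺) such that for every ε > 0 and every C ∈ p there exists x ∈ (0,ε)^v with M·x ∈ C^u. Then: (i) there exists an idempotent q ∈ 0⁺((ℝ⁺)^v) such that φ̃(q) = (p,…,p); (ii) if moreover p is a minimal idempotent of 0⁺(ℝ⁺) (i.e., p ∈ K(0⁺(ℝ⁺))), then q can be chosen to be a minimal idempotent of 0⁺((ℝ⁺)^v), and φ̃[K(0⁺((ℝ⁺)^v))] = φ̃[0⁺((ℝ⁺)^v)] ∩ (K(0⁺(ℝ⁺)))^u. -/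
open Set Filter

attribute [local instance] Ultrafilter.add Ultrafilter.addSemigroup

/-- The `i`-th component of the continuous extension `φ̃` of `φ(x) = M·x` applied to `q`:
the pushforward (image) ultrafilter of `q` under `x ↦ (M·x)ᵢ` (values read in `ℝ`). -/
def phiMap {u v : ℕ} (M : Fin u → Fin v → ℝ) (q : Ultrafilter (Fin v → Rpos)) :
    Fin u → Ultrafilter ℝ :=
  fun i => Ultrafilter.map (fun x : Fin v → Rpos => ∑ j, M i j * (x j : ℝ)) q

/-- The canonical copy of `p ∈ βℝ⁺` inside `βℝ` (pushforward along the inclusion). -/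
def embed1 (p : Ultrafilter Rpos) : Ultrafilter ℝ :=
  Ultrafilter.map (fun a : Rpos => (a : ℝ)) p

section CompactSubsemigroup

variable {γ : Type} [AddSemigroup γ] {T : Set (Ultrafilter γ)}

/-- `x` generates a minimal left ideal of `T`: it lies in `T + (y + x)` for every `y ∈ T`. -/
def GeneratesMinimalLeftIdeal (T : Set (Ultrafilter γ)) (x : Ultrafilter γ) : Prop :=
  x ∈ T ∧ ∀ y ∈ T, ∃ t ∈ T, x = t + (y + x)

theorem GeneratesMinimalLeftIdeal.add_left (hT : ∀ x ∈ T, ∀ y ∈ T, x + y ∈ T)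
    {x z : Ultrafilter γ} (hx : GeneratesMinimalLeftIdeal T x) (hz : z ∈ T) :
    GeneratesMinimalLeftIdeal T (z + x) := by
  refine ⟨hT _ hz _ hx.1, fun y hy => ?_⟩
  obtain ⟨t, ht, h⟩ := hx.2 (y + z) (hT _ hy _ hz)
  refine ⟨z + t, hT _ hz _ ht, ?_⟩
  calc z + x = z + (t + (y + z + x)) := by rw [← h]
    _ = z + t + (y + (z + x)) := by simp only [add_assoc]

theorem GeneratesMinimalLeftIdeal.add_right (hT : ∀ x ∈ T, ∀ y ∈ T, x + y ∈ T)
    {x z : Ultrafilter γ} (hx : GeneratesMinimalLeftIdeal T x) (hz : z ∈ T) :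
    GeneratesMinimalLeftIdeal T (x + z) := by
  refine ⟨hT _ hx.1 _ hz, fun y hy => ?_⟩
  obtain ⟨t, ht, h⟩ := hx.2 y hy
  refine ⟨t, ht, ?_⟩
  calc x + z = t + (y + x) + z := by rw [← h]
    _ = t + (y + (x + z)) := by simp only [add_assoc]

theorem GeneratesMinimalLeftIdeal.memK {x : Ultrafilter γ}
    (hx : GeneratesMinimalLeftIdeal T x) : memK T x := by
  refine ⟨hx.1, fun I hI => ?_⟩
  obtain ⟨⟨y, hy⟩, hIT, hl, hr⟩ := hI
  obtain ⟨t, ht, h⟩ := hx.2 y (hIT hy)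
  rw [h]
  exact hl t ht _ (hr x hx.1 y hy)

/-- Every principal left ideal of a compact subsemigroup contains an idempotent that generates
a minimal left ideal. -/
theorem exists_idempotent_generatesMinimalLeftIdeal (hcl : IsClosed T)
    (hT : ∀ x ∈ T, ∀ y ∈ T, x + y ∈ T) {q : Ultrafilter γ} (hq : q ∈ T) :
    ∃ e, GeneratesMinimalLeftIdeal T e ∧ e + e = e ∧ ∃ t ∈ T, e = t + q := by
  have hclosed : ∀ x, IsClosed ((fun t => t + x) '' T) := fun x =>
    (hcl.isCompact.image (Ultrafilter.continuous_add_left x)).isClosed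
  let S : Set (Set (Ultrafilter γ)) :=
    {L | IsClosed L ∧ L.Nonempty ∧ ∀ t ∈ T, ∀ x ∈ L, t + x ∈ L}
  have hprincipal : ∀ x ∈ T, (fun t => t + x) '' T ∈ S := by
    refine fun x hx => ⟨hclosed x, ⟨_, mem_image_of_mem _ hx⟩, ?_⟩
    rintro t ht _ ⟨s, hs, rfl⟩
    exact ⟨t + s, hT _ ht _ hs, add_assoc _ _ _⟩
  obtain ⟨L, hLq, hL⟩ := zorn_superset_nonempty S (fun c hcS hc hcne => by
    refine ⟨⋂₀ c, ⟨isClosed_sInter fun s hs => (hcS hs).1, ?_, ?_⟩,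
      fun s hs => sInter_subset_of_mem hs⟩
    · have := hcne.to_subtype
      have hdir : DirectedOn (· ⊇ ·) c := fun s hs t ht =>
        (hc.total hs ht).elim (fun h => ⟨s, hs, Subset.rfl, h⟩) fun h => ⟨t, ht, h, Subset.rfl⟩
      exact IsCompact.nonempty_sInter_of_directed_nonempty_isCompact_isClosed hdir
        (fun s hs => (hcS hs).2.1) (fun s hs => (hcS hs).1.isCompact)
        (fun s hs => (hcS hs).1)
    · exact fun t ht x hx s hs => (hcS hs).2.2 t ht x (hx s hs)) _ (hprincipal q hq)
  have hLT : L ⊆ T := by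
    intro x hx
    obtain ⟨t, ht, rfl⟩ := hLq hx
    exact hT _ ht _ hq
  obtain ⟨e, heL, he⟩ := exists_idempotent_in_compact_add_subsemigroup
    Ultrafilter.continuous_add_left L hL.prop.2.1 hL.prop.1.isCompact
    (fun x hx y hy => hL.prop.2.2 x (hLT hx) y hy)
  refine ⟨e, ⟨hLT heL, fun y hy => ?_⟩, he, ?_⟩
  · have hye := hL.prop.2.2 y hy e heL
    have hsub : (fun t => t + (y + e)) '' T ⊆ L := by
      rintro _ ⟨t, ht, rfl⟩
      exact hL.prop.2.2 t ht _ hye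
    obtain ⟨t, ht, h⟩ := hL.le_of_le (hprincipal _ (hLT hye)) hsub heL
    exact ⟨t, ht, h.symm⟩
  · obtain ⟨t, ht, h⟩ := hLq heL
    exact ⟨t, ht, h.symm⟩

theorem generatesMinimalLeftIdeal_of_memK (hcl : IsClosed T)
    (hT : ∀ x ∈ T, ∀ y ∈ T, x + y ∈ T) {x : Ultrafilter γ} (hx : memK T x) :
    GeneratesMinimalLeftIdeal T x := by
  obtain ⟨e, he, -⟩ := exists_idempotent_generatesMinimalLeftIdeal hcl hT hx.1
  exact hx.2 {y | GeneratesMinimalLeftIdeal T y} ⟨⟨e, he⟩, fun _ h => h.1,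
    fun _ hp _ hq => hq.add_left hT hp, fun _ hp _ hq => hq.add_right hT hp⟩

theorem isIdealIn_setOf_memK (hcl : IsClosed T) (hT : ∀ x ∈ T, ∀ y ∈ T, x + y ∈ T)
    (hne : T.Nonempty) : IsIdealIn T {x | memK T x} := by
  obtain ⟨q, hq⟩ := hne
  obtain ⟨e, he, -⟩ := exists_idempotent_generatesMinimalLeftIdeal hcl hT hq
  refine ⟨⟨e, he.memK⟩, fun _ h => h.1, fun p hp q hq => ?_, fun p hp q hq => ?_⟩
  · exact ((generatesMinimalLeftIdeal_of_memK hcl hT hq).add_left hT hp).memK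
  · exact ((generatesMinimalLeftIdeal_of_memK hcl hT hq).add_right hT hp).memK

/-- An idempotent in the minimal left ideal generated by `x` is a right identity for `x`. -/
theorem GeneratesMinimalLeftIdeal.add_idempotent {x f t : Ultrafilter γ}
    (hx : GeneratesMinimalLeftIdeal T x) (hf : f + f = f) (ht : t ∈ T) (hft : f = t + x) :
    x + f = x := by
  obtain ⟨s, -, hs⟩ := hx.2 t ht
  rw [← hft] at hs
  calc x + f = s + f + f := by rw [← hs]
    _ = x := by rw [add_assoc, hf, ← hs]

end CompactSubsemigroup

theorem Ultrafilter.map_add_of_addHom {α β : Type*} [Add α] [Add β] (f : α →ₙ+ β)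
    (p q : Ultrafilter α) : (p + q).map f = p.map f + q.map f := by
  apply Ultrafilter.coe_injective
  ext s
  change (∀ᶠ x in ((p + q : Ultrafilter α) : Filter α), f x ∈ s) ↔
    ∀ᶠ y in ((p.map f + q.map f : Ultrafilter β) : Filter β), y ∈ s
  rw [Ultrafilter.eventually_add, Ultrafilter.eventually_add]
  simp only [Ultrafilter.coe_map, Filter.eventually_map, map_add]

theorem isClosed_setOf_map_eq {α β : Type*} (f : α → β) (p : Ultrafilter β) :
    IsClosed {q : Ultrafilter α | q.map f = p} := by
  have h : {q : Ultrafilter α | q.map f = p} = ⋂ C ∈ p, {q : Ultrafilter α | f ⁻¹' C ∈ q} := by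
    ext q
    simp only [mem_iInter, mem_ofPred_eq, ← Ultrafilter.coe_le_coe]
    exact Iff.rfl
  rw [h]
  exact isClosed_biInter fun C _ => ultrafilter_isClosed_basic _

section Lift

variable {γ δ ι : Type} [AddSemigroup γ] [AddSemigroup δ]
  {T : Set (Ultrafilter γ)} {U : Set (Ultrafilter δ)}

/-- If all images of `q` under homomorphisms `T → U` lie in `K(U)`, then `q` can be moved into
`K(T)` by adding an idempotent on the right, without changing the images. -/
theorem exists_add_mem_memK_map_eq (hTcl : IsClosed T) (hT : ∀ x ∈ T, ∀ y ∈ T, x + y ∈ T)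
    (hUcl : IsClosed U) (hU : ∀ x ∈ U, ∀ y ∈ U, x + y ∈ U) (f : ι → γ →ₙ+ δ)
    (hf : ∀ i, ∀ q ∈ T, q.map (f i) ∈ U) {q : Ultrafilter γ} (hq : q ∈ T)
    (hqK : ∀ i, memK U (q.map (f i))) :
    ∃ e, memK T (q + e) ∧ e + e = e ∧ (∃ t, e = t + q) ∧
      ∀ i, (q + e).map (f i) = q.map (f i) := by
  obtain ⟨e, he, hee, t, ht, het⟩ := exists_idempotent_generatesMinimalLeftIdeal hTcl hT hq
  refine ⟨e, (he.add_left hT hq).memK, hee, ⟨t, het⟩, fun i => ?_⟩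
  rw [Ultrafilter.map_add_of_addHom]
  refine (generatesMinimalLeftIdeal_of_memK hUcl hU (hqK i)).add_idempotent ?_ (hf i t ht) ?_
  · rw [← Ultrafilter.map_add_of_addHom, hee]
  · rw [← Ultrafilter.map_add_of_addHom, ← het]

theorem memK_map_of_memK (hUcl : IsClosed U) (hU : ∀ x ∈ U, ∀ y ∈ U, x + y ∈ U)
    (hT : ∀ x ∈ T, ∀ y ∈ T, x + y ∈ T) (f : γ →ₙ+ δ)
    (hf : ∀ q ∈ T, q.map f ∈ U) {r : Ultrafilter γ} (hr : r ∈ T) (hrK : memK U (r.map f))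
    {q : Ultrafilter γ} (hq : memK T q) : memK U (q.map f) := by
  have hK := isIdealIn_setOf_memK hUcl hU ⟨_, hrK.1⟩
  refine (hq.2 {q | q ∈ T ∧ memK U (q.map f)}
    ⟨⟨r, hr, hrK⟩, fun _ h => h.1, fun a ha b hb => ⟨hT _ ha _ hb.1, ?_⟩,
      fun a ha b hb => ⟨hT _ hb.1 _ ha, ?_⟩⟩).2
  · rw [Ultrafilter.map_add_of_addHom]
    exact hK.2.2.1 _ (hf a ha) _ hb.2
  · rw [Ultrafilter.map_add_of_addHom]
    exact hK.2.2.2 _ (hf a ha) _ hb.2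

end Lift

theorem isClosed_zeroPlus1 : IsClosed zeroPlus1 := by
  simp only [zeroPlus1, ofPred_forall]
  exact isClosed_iInter fun _ => isClosed_iInter fun _ => ultrafilter_isClosed_basic _

theorem isClosed_zeroPlusV (v : ℕ) : IsClosed (zeroPlusV v) := by
  simp only [zeroPlusV, ofPred_forall]
  exact isClosed_iInter fun _ => isClosed_iInter fun _ => ultrafilter_isClosed_basic _

theorem add_mem_zeroPlus1 : ∀ p ∈ zeroPlus1, ∀ q ∈ zeroPlus1, p + q ∈ zeroPlus1 := by
  intro p hp q hq ε hε
  refine (Ultrafilter.eventually_add p q (fun x : Rpos => (x : ℝ) < ε)).2 ?_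
  filter_upwards [hp (ε / 2) (half_pos hε)] with x hx
  filter_upwards [hq (ε / 2) (half_pos hε)] with y hy
  change (x : ℝ) < ε / 2 at hx
  change (y : ℝ) < ε / 2 at hy
  rw [Positive.coe_add]
  linarith

theorem add_mem_zeroPlusV (v : ℕ) :
    ∀ p ∈ zeroPlusV v, ∀ q ∈ zeroPlusV v, p + q ∈ zeroPlusV v := by
  intro p hp q hq ε hε
  refine (Ultrafilter.eventually_add p q (fun x : Fin v → Rpos => ∀ j, (x j : ℝ) < ε)).2 ?_
  filter_upwards [hp (ε / 2) (half_pos hε)] with x hx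
  filter_upwards [hq (ε / 2) (half_pos hε)] with y hy
  intro j
  have hxj := hx j
  have hyj := hy j
  rw [Pi.add_apply, Positive.coe_add]
  linarith

section Row

variable {v : ℕ}

theorem sum_mul_pos_of_ne_zero {a : Fin v → ℝ} (ha : ∀ j, 0 ≤ a j) (hne : ∃ j, a j ≠ 0)
    (x : Fin v → Rpos) : 0 < ∑ j, a j * (x j : ℝ) := by
  obtain ⟨j, hj⟩ := hne
  exact Finset.sum_pos' (fun i _ => mul_nonneg (ha i) (x i).2.le)
    ⟨j, Finset.mem_univ _, mul_pos (lt_of_le_of_ne (ha j) hj.symm) (x j).2⟩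

/-- The homomorphism `(ℝ⁺)^v → ℝ⁺` given by a nonzero row with nonnegative entries. -/
def rowHom (a : Fin v → ℝ) (ha : ∀ j, 0 ≤ a j) (hne : ∃ j, a j ≠ 0) :
    (Fin v → Rpos) →ₙ+ Rpos where
  toFun x := ⟨∑ j, a j * (x j : ℝ), sum_mul_pos_of_ne_zero ha hne x⟩
  map_add' x y := by
    apply Subtype.ext
    simp [mul_add, Finset.sum_add_distrib]

theorem map_rowHom_mem_zeroPlus1 (a : Fin v → ℝ) (ha : ∀ j, 0 ≤ a j) (hne : ∃ j, a j ≠ 0)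
    {q : Ultrafilter (Fin v → Rpos)} (hq : q ∈ zeroPlusV v) :
    q.map (rowHom a ha hne) ∈ zeroPlus1 := by
  intro ε hε
  have hs : 0 ≤ ∑ j, a j := Finset.sum_nonneg fun j _ => ha j
  have hpos : 0 < 1 + ∑ j, a j := by linarith
  rw [Ultrafilter.mem_map]
  filter_upwards [hq (ε / (1 + ∑ j, a j)) (div_pos hε hpos)] with x hx
  change ∑ j, a j * (x j : ℝ) < ε
  calc ∑ j, a j * (x j : ℝ) ≤ ∑ j, a j * (ε / (1 + ∑ j, a j)) :=
        Finset.sum_le_sum fun j _ => mul_le_mul_of_nonneg_left (hx j).le (ha j)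
    _ = (∑ j, a j) * ε / (1 + ∑ j, a j) := by rw [← Finset.sum_mul, mul_div_assoc]
    _ < ε := by
        rw [div_lt_iff₀ hpos]
        linarith

end Row

theorem embed1_injective : Function.Injective embed1 := by
  intro p q h
  apply Ultrafilter.coe_injective
  have h' := congrArg (fun r : Ultrafilter ℝ => (r : Filter ℝ)) h
  exact Filter.map_injective Subtype.val_injective h'

theorem phiMap_apply_eq_embed1 {u v : ℕ} (M : Fin u → Fin v → ℝ) (hMnn : ∀ i j, 0 ≤ M i j)
    (hrow : ∀ i, ∃ j, M i j ≠ 0) (q : Ultrafilter (Fin v → Rpos)) (i : Fin u) :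
    phiMap M q i = embed1 (q.map (rowHom (M i) (hMnn i) (hrow i))) :=
  rfl

/-- A family of maps hitting every `C ∈ p` simultaneously and arbitrarily close to zero sends some
`q ∈ 0⁺((ℝ⁺)^v)` to `p` in every coordinate. -/
theorem exists_mem_zeroPlusV_map_eq {v : ℕ} {ι : Type*} (f : ι → (Fin v → Rpos) → Rpos)
    (p : Ultrafilter Rpos)
    (h : ∀ ε : ℝ, 0 < ε → ∀ C ∈ p, ∃ x : Fin v → Rpos, (∀ j, (x j : ℝ) < ε) ∧ ∀ k, f k x ∈ C) :
    ∃ q ∈ zeroPlusV v, ∀ k, q.map (f k) = p := by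
  let B : ℝ → Set Rpos → Set (Fin v → Rpos) := fun ε C =>
    {x | (∀ j, (x j : ℝ) < ε) ∧ ∀ k, f k x ∈ C}
  let F : Filter (Fin v → Rpos) :=
    { sets := {s | ∃ ε : ℝ, 0 < ε ∧ ∃ C ∈ p, B ε C ⊆ s}
      univ_sets := ⟨1, one_pos, univ, Filter.univ_mem, subset_univ _⟩
      sets_of_superset := by
        rintro s t ⟨ε, hε, C, hC, hs⟩ hst
        exact ⟨ε, hε, C, hC, hs.trans hst⟩
      inter_sets := by
        rintro s t ⟨ε, hε, C, hC, hs⟩ ⟨δ, hδ, D, hD, ht⟩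
        refine ⟨min ε δ, lt_min hε hδ, C ∩ D, Filter.inter_mem hC hD, fun x hx => ⟨hs ?_, ht ?_⟩⟩
        · exact ⟨fun j => (hx.1 j).trans_le (min_le_left _ _), fun k => (hx.2 k).1⟩
        · exact ⟨fun j => (hx.1 j).trans_le (min_le_right _ _), fun k => (hx.2 k).2⟩ }
  have hF : F.NeBot := by
    rw [← Filter.forall_mem_nonempty_iff_neBot]
    rintro s ⟨ε, hε, C, hC, hs⟩
    obtain ⟨x, hx⟩ := h ε hε C hC
    exact ⟨x, hs hx⟩
  refine ⟨Ultrafilter.of F, fun ε hε => Ultrafilter.of_le F ?_, fun k => ?_⟩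
  · exact ⟨ε, hε, univ, Filter.univ_mem, fun x hx => hx.1⟩
  · refine Ultrafilter.coe_le_coe.1 fun C hC => Ultrafilter.of_le F ?_
    exact ⟨1, one_pos, C, hC, fun x hx => hx.2 k⟩

/-- Let `M` be a `u × v` matrix with entries from `ℝ⁺ ∪ {0}` and no zero row, and let
`p` be an idempotent in `0⁺(ℝ⁺)` such that for every `ε > 0` and every `C ∈ p` there is
`x ∈ (0,ε)^v` with `M·x ∈ C^u`.  Then (i) there is an idempotent `q ∈ 0⁺((ℝ⁺)^v)` with
`φ̃(q) = (p,…,p)`; and (ii) if `p` is a minimal idempotent, then `q` can be chosen to be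
a minimal idempotent, and `φ̃[K(0⁺((ℝ⁺)^v))] = φ̃[0⁺((ℝ⁺)^v)] ∩ (K(0⁺(ℝ⁺)))^u`. -/
theorem exists_idempotent_preimage_of_idempotent {u v : ℕ} (hu : 1 ≤ u) (hv : 1 ≤ v)
    (M : Fin u → Fin v → ℝ) (hMnn : ∀ i j, 0 ≤ M i j) (hrow : ∀ i, ∃ j, M i j ≠ 0)
    (p : Ultrafilter Rpos) (hp : p ∈ zeroPlus1) (hidem : p + p = p)
    (himage : ∀ ε : ℝ, 0 < ε → ∀ C ∈ p, ∃ x : Fin v → Rpos, (∀ j, (x j : ℝ) < ε) ∧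
      ∀ k : Fin u, ∃ h : 0 < ∑ j, M k j * (x j : ℝ),
        (⟨∑ j, M k j * (x j : ℝ), h⟩ : Rpos) ∈ C) :
    (∃ q ∈ zeroPlusV v, q + q = q ∧ phiMap M q = fun _ => embed1 p) ∧
    (memK zeroPlus1 p →
      (∃ q, memK (zeroPlusV v) q ∧ q + q = q ∧ phiMap M q = fun _ => embed1 p) ∧
      phiMap M '' {q | memK (zeroPlusV v) q} =
        phiMap M '' zeroPlusV v ∩
          {t : Fin u → Ultrafilter ℝ | ∀ i, ∃ p' : Ultrafilter Rpos,
            memK zeroPlus1 p' ∧ t i = embed1 p'}) := by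
  let f : Fin u → (Fin v → Rpos) →ₙ+ Rpos := fun i => rowHom (M i) (hMnn i) (hrow i)
  have hphi : ∀ q i, phiMap M q i = embed1 (q.map (f i)) :=
    phiMap_apply_eq_embed1 M hMnn hrow
  have hf : ∀ i, ∀ q ∈ zeroPlusV v, q.map (f i) ∈ zeroPlus1 := fun i q hq =>
    map_rowHom_mem_zeroPlus1 (M i) (hMnn i) (hrow i) hq
  have hTcl := isClosed_zeroPlusV v
  have hT := add_mem_zeroPlusV v
  have hUcl := isClosed_zeroPlus1
  have hU := add_mem_zeroPlus1
  have hidempotent : ∃ q ∈ zeroPlusV v, q + q = q ∧ ∀ i, q.map (f i) = p := by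
    obtain ⟨q₀, hq₀, hq₀p⟩ := exists_mem_zeroPlusV_map_eq (fun i => f i) p fun ε hε C hC => by
      obtain ⟨x, hx, hxC⟩ := himage ε hε C hC
      exact ⟨x, hx, fun k => (hxC k).2⟩
    have hclosed : IsClosed {q : Ultrafilter (Fin v → Rpos) | ∀ i, q.map (f i) = p} := by
      rw [ofPred_forall]
      exact isClosed_iInter fun i => isClosed_setOf_map_eq _ _
    obtain ⟨q, hq, hqq⟩ := exists_idempotent_in_compact_add_subsemigroup
      Ultrafilter.continuous_add_left (zeroPlusV v ∩ {q | ∀ i, q.map (f i) = p})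
      ⟨q₀, hq₀, hq₀p⟩ (hTcl.inter hclosed).isCompact
      (fun x hx y hy => ⟨hT x hx.1 y hy.1, fun i => by
        rw [Ultrafilter.map_add_of_addHom, hx.2 i, hy.2 i, hidem]⟩)
    exact ⟨q, hq.1, hqq, hq.2⟩
  obtain ⟨q, hq, hqq, hqp⟩ := hidempotent
  refine ⟨⟨q, hq, hqq, funext fun i => by rw [hphi, hqp]⟩, fun hpK => ⟨?_, ?_⟩⟩
  · obtain ⟨e, he, hee, ⟨t, het⟩, hmap⟩ := exists_add_mem_memK_map_eq hTcl hT hUcl hU f hf hq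
      fun i => by rw [hqp]; exact hpK
    have heq : e + q = e := by rw [het, add_assoc, hqq]
    refine ⟨q + e, he, ?_, funext fun i => by rw [hphi, hmap, hqp]⟩
    calc q + e + (q + e) = q + (e + q + e) := by simp only [add_assoc]
      _ = q + e := by rw [heq, hee]
  · ext t
    constructor
    · rintro ⟨r, hr, rfl⟩
      refine ⟨⟨r, hr.1, rfl⟩, fun i => ⟨r.map (f i), ?_, hphi r i⟩⟩
      exact memK_map_of_memK hUcl hU hT (f i) (hf i) hq (by rw [hqp]; exact hpK) hr
    · rintro ⟨⟨r, hr, rfl⟩, hK⟩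
      obtain ⟨e, he, -, -, hmap⟩ := exists_add_mem_memK_map_eq hTcl hT hUcl hU f hf hr fun i => by
        obtain ⟨p', hp', h⟩ := hK i
        rw [hphi] at h
        rwa [embed1_injective h]
      exact ⟨r + e, he, funext fun i => by rw [hphi, hphi, hmap]⟩
end
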